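/- Let d ≥ 1, let Γ be a d×d symmetric positive definite real matrix, and let R be a d×d nonsingular M-matrix. Suppose that for each r ∈ (0,1) there are Borel probability measures π^r, ν_1^r, …, ν_d^r on ℝ₊^d satisfying the basic adjoint relationship. Then, as r → 0, the pushforward of π^r under the map z ↦ (r z_1, r² z_2, …, r^d z_d) converges weakly to the law of a vector (Z_1*, …, Z_d*) of independent random variables in which Z_k* is exponentially distributed with mean m_k = (u_kᵀ Γ u_k)/(2 u_kᵀ R_{:,k}) > 0. -/

import Mathlib

open MeasureTheory Filter

noncomputable section

namespace SRBMPaper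

/-- The nonnegative orthant `ℝ₊^d`. -/
def posOrthant (d : ℕ) : Set (Fin d → ℝ) := {z | ∀ i, 0 ≤ z i}

/-- `R` is a P-matrix: every principal minor is positive. -/
def IsPMatrix {d : ℕ} (R : Matrix (Fin d) (Fin d) ℝ) : Prop :=
  ∀ s : Finset (Fin d),
    0 < (R.submatrix (fun i : s => (i : Fin d)) (fun i : s => (i : Fin d))).det

/-- `R` is a nonsingular M-matrix: nonpositive off-diagonal entries and
every principal minor positive. -/
def IsMMatrix {d : ℕ} (R : Matrix (Fin d) (Fin d) ℝ) : Prop :=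
  (∀ i j, i ≠ j → R i j ≤ 0) ∧ IsPMatrix R

/-- First-order partial derivative of `f` in coordinate `j`. -/
def pd1 {d : ℕ} (f : (Fin d → ℝ) → ℝ) (j : Fin d) (z : Fin d → ℝ) : ℝ :=
  fderiv ℝ f z (Pi.single j 1)

/-- Second-order partial derivative of `f` in coordinates `i`, `j`. -/
def pd2 {d : ℕ} (f : (Fin d → ℝ) → ℝ) (i j : Fin d) (z : Fin d → ℝ) : ℝ :=
  fderiv ℝ (fun w => pd1 f j w) z (Pi.single i 1)

/-- `f` is twice continuously differentiable and `f` together with all of its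
first- and second-order partial derivatives is bounded on the orthant. -/
def IsC2Bounded {d : ℕ} (f : (Fin d → ℝ) → ℝ) : Prop :=
  ContDiff ℝ 2 f ∧
    ∃ C : ℝ, ∀ z ∈ posOrthant d,
      |f z| ≤ C ∧ (∀ j, |pd1 f j z| ≤ C) ∧ (∀ i j, |pd2 f i j z| ≤ C)

/-- The basic adjoint relationship (BAR) at traffic-intensity parameter `r`. -/
def SatisfiesBAR {d : ℕ} (Γ R : Matrix (Fin d) (Fin d) ℝ) (r : ℝ)
    (π : Measure (Fin d → ℝ)) (ν : Fin d → Measure (Fin d → ℝ)) : Prop :=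
  ∀ f : (Fin d → ℝ) → ℝ, IsC2Bounded f →
    (1 / 2) * (∫ z, ∑ i, ∑ j, Γ i j * pd2 f i j z ∂π)
      - (∑ i : Fin d, r ^ ((i : ℕ) + 1) * ∫ z, ∑ j, R j i * pd1 f j z ∂π)
      + (∑ i : Fin d, r ^ ((i : ℕ) + 1) * ∫ z, ∑ j, R j i * pd1 f j z ∂(ν i)) = 0

/-- For every `r ∈ (0,1)`, `π r` is a Borel probability measure on the orthant,
each `ν i r` is a Borel probability measure on the face `{z i = 0}` of the orthant,
and together they satisfy the basic adjoint relationship. -/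
def BARFamily {d : ℕ} (Γ R : Matrix (Fin d) (Fin d) ℝ)
    (π : ℝ → Measure (Fin d → ℝ)) (ν : Fin d → ℝ → Measure (Fin d → ℝ)) : Prop :=
  ∀ r ∈ Set.Ioo (0 : ℝ) 1,
    IsProbabilityMeasure (π r) ∧ π r (posOrthant d) = 1 ∧
    (∀ i, IsProbabilityMeasure (ν i r) ∧
      ν i r {z | z ∈ posOrthant d ∧ z i = 0} = 1) ∧
    SatisfiesBAR Γ R r (π r) (fun i => ν i r)

/-- `u` is the vector `u_k` associated with the matrix `R`:
`u_k = (w_{1k}, …, w_{k-1,k}, 1, 0, …, 0)ᵀ` where the weights solve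
`∑_{j<k} w_{jk} R_{jℓ} + R_{kℓ} = 0` for all `ℓ < k`. -/
def IsUk {d : ℕ} (R : Matrix (Fin d) (Fin d) ℝ) (k : Fin d) (u : Fin d → ℝ) : Prop :=
  u k = 1 ∧ (∀ j, k < j → u j = 0) ∧
    ∀ ℓ, ℓ < k →
      (∑ j ∈ Finset.univ.filter (fun j => j < k), u j * R j ℓ) + R k ℓ = 0

/-- `uᵀ R_{:,i}`, the pairing of `u` with the `i`-th column of `R`. -/
def uR {d : ℕ} (R : Matrix (Fin d) (Fin d) ℝ) (u : Fin d → ℝ) (i : Fin d) : ℝ :=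
  ∑ j, u j * R j i

/-- The quadratic form `uᵀ Γ u`. -/
def quadForm {d : ℕ} (Γ : Matrix (Fin d) (Fin d) ℝ) (u : Fin d → ℝ) : ℝ :=
  ∑ i, ∑ j, u i * Γ i j * u j

/-- The limiting mean `m_k = (u_kᵀ Γ u_k) / (2 u_kᵀ R_{:,k})`. -/
def meanOf {d : ℕ} (Γ R : Matrix (Fin d) (Fin d) ℝ) (u : Fin d → ℝ) (k : Fin d) : ℝ :=
  quadForm Γ u / (2 * uR R u k)

/-- The exponential distribution on `ℝ` with mean `m`. -/
def expMean (m : ℝ) : Measure ℝ :=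
  (volume : Measure ℝ).withDensity fun x =>
    ENNReal.ofReal (if 0 ≤ x then m⁻¹ * Real.exp (-x / m) else 0)

/-- The law of a vector of independent exponential random variables with means `m k`. -/
def prodExp {d : ℕ} (m : Fin d → ℝ) : Measure (Fin d → ℝ) :=
  Measure.pi fun k => expMean (m k)

/-- The pushforwards of `π r` under `z ↦ (r z_1, r² z_2, …, r^d z_d)` converge weakly
to `μ` as `r → 0` (convergence tested against bounded continuous functions). -/
def ScaledWeakLimit {d : ℕ} (π : ℝ → Measure (Fin d → ℝ)) (μ : Measure (Fin d → ℝ)) : Prop :=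
  ∀ g : BoundedContinuousFunction (Fin d → ℝ) ℝ,
    Tendsto (fun r : ℝ => ∫ z, g (fun i => r ^ ((i : ℕ) + 1) * z i) ∂(π r))
      (nhdsWithin 0 (Set.Ioo 0 1)) (nhds (∫ z, g z ∂μ))

/-- The uniform moment bound condition: for all coordinates `i, k`, the `d`-th moment
of `r^k Z_k` under `π r` is bounded for small `r`, and `r` times its `d`-th moment
under `ν i r` tends to `0` as `r → 0`. -/
def UniformMomentBound {d : ℕ} (π : ℝ → Measure (Fin d → ℝ))
    (ν : Fin d → ℝ → Measure (Fin d → ℝ)) : Prop :=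
  ∀ i k : Fin d,
    (∃ r₁ > (0 : ℝ), ∃ C : ℝ, ∀ r ∈ Set.Ioo (0 : ℝ) (min r₁ 1),
      (∫ z, (r ^ ((k : ℕ) + 1) * z k) ^ d ∂(π r)) ≤ C) ∧
    Tendsto (fun r : ℝ => r * ∫ z, (r ^ ((k : ℕ) + 1) * z k) ^ d ∂(ν i r))
      (nhdsWithin 0 (Set.Ioo 0 1)) (nhds 0)

/-- The truncation function `κ`. -/
def kappa (x : ℝ) : ℝ :=
  if x ≤ 1 then x
  else if x ≤ 2 then 3*x^5 - 22*x^4 + 62*x^3 - 84*x^2 + 56*x - 14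
  else 2

/-- The vector `θ_k^{(r)} = ∑_{ℓ=k}^d r^ℓ η_ℓ u_ℓ`. -/
def thetaK {d : ℕ} (u : Fin d → Fin d → ℝ) (η : Fin d → ℝ) (k : Fin d) (r : ℝ) :
    Fin d → ℝ :=
  fun j => ∑ ℓ ∈ Finset.univ.filter (fun ℓ => k ≤ ℓ), r ^ ((ℓ : ℕ) + 1) * η ℓ * u ℓ j

/-- The vector `θ̃_k^{(r)} = r^{k+1/2} η_k u_k + ∑_{ℓ=k+1}^d r^ℓ η_ℓ u_ℓ`. -/
def thetaKt {d : ℕ} (u : Fin d → Fin d → ℝ) (η : Fin d → ℝ) (k : Fin d) (r : ℝ) :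
    Fin d → ℝ :=
  fun j => r ^ ((((k : ℕ) : ℝ) + 1) + 1/2) * η k * u k j
    + ∑ ℓ ∈ Finset.univ.filter (fun ℓ => k < ℓ), r ^ ((ℓ : ℕ) + 1) * η ℓ * u ℓ j

/-- The truncated exponential test function `f̃_θ(z) = exp(∑ κ(θ_i z_i))`. -/
def ftilde {d : ℕ} (θ z : Fin d → ℝ) : ℝ := Real.exp (∑ i, kappa (θ i * z i))

/-- Gradient extra term `ε_{g,θ,j}(z) = θ_j (κ'(θ_j z_j) − 1)`. -/
def epsG {d : ℕ} (θ : Fin d → ℝ) (j : Fin d) (z : Fin d → ℝ) : ℝ :=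
  θ j * (deriv kappa (θ j * z j) - 1)

/-- Hessian extra term `ε_{H,θ,ij}(z)`. -/
def epsH {d : ℕ} (θ : Fin d → ℝ) (i j : Fin d) (z : Fin d → ℝ) : ℝ :=
  θ i * θ j * (deriv kappa (θ i * z i) * deriv kappa (θ j * z j) - 1)
    + (if i = j then θ i ^ 2 * deriv (deriv kappa) (θ i * z i) else 0)

/-- The extra term `γ^r(θ)` in the truncated MGF-BAR. -/
def gammaTerm {d : ℕ} (Γ R : Matrix (Fin d) (Fin d) ℝ) (r : ℝ)
    (π : Measure (Fin d → ℝ)) (ν : Fin d → Measure (Fin d → ℝ))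
    (θ : Fin d → ℝ) : ℝ :=
  (1/2) * (∫ z, (∑ i, ∑ j, Γ i j * epsH θ i j z) * ftilde θ z ∂π)
    + ∑ i : Fin d, r ^ ((i : ℕ) + 1) *
        ((∫ z, (∑ j, epsG θ j z * R j i) * ftilde θ z ∂(ν i))
          - ∫ z, (∑ j, epsG θ j z * R j i) * ftilde θ z ∂π)


section LinearAlgebra

variable {d : ℕ} {R : Matrix (Fin d) (Fin d) ℝ}

lemma uR_add (x y : Fin d → ℝ) (i : Fin d) : uR R (x + y) i = uR R x i + uR R y i := by
  simp [uR, add_mul, Finset.sum_add_distrib]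

lemma uR_smul (a : ℝ) (x : Fin d → ℝ) (i : Fin d) : uR R (a • x) i = a * uR R x i := by
  simp [uR, Finset.mul_sum, mul_assoc]

lemma uR_sum {ι : Type*} (s : Finset ι) (x : ι → Fin d → ℝ) (i : Fin d) :
    uR R (∑ a ∈ s, x a) i = ∑ a ∈ s, uR R (x a) i := by
  simp only [uR, Finset.sum_apply, Finset.sum_mul]
  exact Finset.sum_comm

lemma uR_single (k : Fin d) (i : Fin d) : uR R (Pi.single k 1) i = R k i := by
  simp [uR, Pi.single_apply]

lemma IsUk.uR_eq_zero {k : Fin d} {u : Fin d → ℝ} (hu : IsUk R k u) {l : Fin d} (hl : l < k) :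
    uR R u l = 0 := by
  obtain ⟨h1, h2, h3⟩ := hu
  rw [← h3 l hl, uR, ← Finset.sum_filter_add_sum_filter_not Finset.univ (fun j => j < k)]
  congr 1
  rw [Finset.sum_eq_single_of_mem k (by simp)]
  · simp [h1]
  · intro j hj hjk
    have : k < j := lt_of_le_of_ne (by simpa using hj) (Ne.symm hjk)
    simp [h2 j this]

lemma IsUk.uR_pos (hR : IsPMatrix R) {u : Fin d → Fin d → ℝ} (hu : ∀ k, IsUk R k (u k))
    (k : Fin d) : 0 < uR R (u k) k := by
  have key : ∀ s : Finset (Fin d), (∀ i ∈ s, ∀ j, j < i → j ∈ s) →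
      0 < ∏ i ∈ s, uR R (u i) i := by
    intro s hs
    let U : Matrix s s ℝ := Matrix.of (fun i j : s => u i j)
    have hU : U.det = 1 := by
      rw [Matrix.det_of_isLowerTriangular]
      · simp [U, (hu _).1]
      · intro i j hij
        exact (hu i).2.1 j hij
    have hT : U * R.submatrix (fun i : s => (i : Fin d)) (fun i : s => (i : Fin d))
        = Matrix.of (fun i j : s => uR R (u i) j) := by
      ext i j
      simp only [Matrix.mul_apply, Matrix.submatrix_apply, Matrix.of_apply, U, uR]
      rw [Finset.sum_coe_sort s (fun l => u i l * R l j)]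
      refine Finset.sum_subset (Finset.subset_univ _) fun l _ hl => ?_
      rw [(hu i).2.1 l, zero_mul]
      by_contra h
      rcases lt_or_eq_of_le (not_lt.mp h) with h | h
      · exact hl (hs i i.2 l h)
      · exact hl (h ▸ i.2)
    have hdet := congrArg Matrix.det hT
    rw [Matrix.det_mul, hU, one_mul, Matrix.det_of_isUpperTriangular
      (M := Matrix.of (fun i j : s => uR R (u i) j))
      (fun i j hij => (hu i).uR_eq_zero hij)] at hdet
    rw [← Finset.prod_coe_sort]
    exact (hR s).trans_eq hdet
  have h1 := key (Finset.Iio k) (fun i hi j hj => by simp at hi ⊢; exact hj.trans hi)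
  have h2 := key (Finset.Iic k) (fun i hi j hj => by simp at hi ⊢; exact hj.le.trans hi)
  rw [← Finset.Iio_insert, Finset.prod_insert (by simp)] at h2
  exact (pos_iff_pos_of_mul_pos h2).mpr h1

lemma uR_nonpos_of_support (hR : IsMMatrix R) {x : Fin d → ℝ} (hx : 0 ≤ x) {i : Fin d}
    (hi : x i = 0) : uR R x i ≤ 0 := by
  refine Finset.sum_nonpos fun j _ => ?_
  by_cases h : j = i
  · simp [h, hi]
  · exact mul_nonpos_of_nonneg_of_nonpos (hx j) (hR.1 j i h)

lemma nonneg_of_uR_nonneg (hR : IsMMatrix R) {u : Fin d → Fin d → ℝ} (hu : ∀ k, IsUk R k (u k))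
    (n : ℕ) (x : Fin d → ℝ) (hx : ∀ i : Fin d, n ≤ (i : ℕ) → x i = 0)
    (hxR : ∀ i : Fin d, (i : ℕ) < n → 0 ≤ uR R x i) : 0 ≤ x := by
  induction n generalizing x with
  | zero => exact fun i => (hx i (Nat.zero_le _)).ge
  | succ n ih =>
    by_cases hn : n < d
    · let k : Fin d := ⟨n, hn⟩
      have huk : 0 ≤ u k := by
        have h0 : 0 ≤ u k + (-1 : ℝ) • Pi.single k 1 := by
          apply ih
          · intro i hi
            by_cases hik : i = k
            · subst hik
              simp [(hu k).1]
            · have : k < i := lt_of_le_of_ne hi (Ne.symm hik)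
              simp [(hu k).2.1 i this, hik]
          · intro i hi
            have hik : i < k := hi
            rw [uR_add, uR_smul, uR_single, (hu k).uR_eq_zero hik]
            linarith [hR.1 k i hik.ne']
        have h1 : (0 : Fin d → ℝ) ≤ Pi.single k 1 := by
          rw [Pi.single_nonneg]; exact zero_le_one
        have := add_nonneg h0 h1
        simpa [add_assoc] using this
      have hx' : 0 ≤ x + (-x k) • u k := by
        apply ih
        · intro i hi
          by_cases hik : i = k
          · subst hik
            simp [(hu k).1]
          · have hki : k < i := lt_of_le_of_ne hi (Ne.symm hik)
            simp [(hu k).2.1 i hki, hx i hki]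
        · intro i hi
          have hik : i < k := hi
          rw [uR_add, uR_smul, (hu k).uR_eq_zero hik]
          simpa using hxR i (by omega)
      have hneg : uR R (x + (-x k) • u k) k ≤ 0 :=
        uR_nonpos_of_support hR hx' (by simp [(hu k).1])
      have hk := hxR k (by simp [k])
      have hpos := IsUk.uR_pos hR.2 hu k
      rw [uR_add, uR_smul] at hneg
      have hxk : 0 ≤ x k := by
        by_contra h
        nlinarith
      have := add_nonneg hx' (smul_nonneg hxk huk)
      simpa [add_assoc] using this
    · exact ih x (fun i hi => absurd i.2 (by omega)) (fun i hi => hxR i (by omega))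

lemma IsUk.nonneg (hR : IsMMatrix R) {u : Fin d → Fin d → ℝ} (hu : ∀ k, IsUk R k (u k))
    (k : Fin d) : 0 ≤ u k := by
  refine nonneg_of_uR_nonneg hR hu (k + 1) _ (fun i hi => (hu k).2.1 i hi) fun i hi => ?_
  rcases lt_or_eq_of_le (show i ≤ k from Nat.lt_succ_iff.mp hi) with h | h
  · exact ((hu k).uR_eq_zero h).ge
  · subst h
    exact (IsUk.uR_pos hR.2 hu i).le

lemma exists_uR_eq_one (hR : IsMMatrix R) {u : Fin d → Fin d → ℝ} (hu : ∀ k, IsUk R k (u k)) :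
    ∃ c : Fin d → ℝ, 0 ≤ c ∧ ∀ i, uR R c i = 1 := by
  have hdet : 0 < R.det := by
    have h := hR.2 Finset.univ
    have he : R.submatrix (fun i : (Finset.univ : Finset (Fin d)) => (i : Fin d))
        (fun i : (Finset.univ : Finset (Fin d)) => (i : Fin d))
        = R.submatrix (Equiv.subtypeUnivEquiv Finset.mem_univ)
          (Equiv.subtypeUnivEquiv Finset.mem_univ) := rfl
    rwa [he, Matrix.det_submatrix_equiv_self] at h
  have hunit : IsUnit R.det := hdet.ne'.isUnit
  have hc : ∀ i, uR R (Matrix.vecMul 1 R⁻¹) i = 1 := by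
    intro i
    change Matrix.vecMul (Matrix.vecMul 1 R⁻¹) R i = 1
    rw [Matrix.vecMul_vecMul, Matrix.nonsing_inv_mul _ hunit]
    simp
  refine ⟨_, nonneg_of_uR_nonneg hR hu d _ (fun i hi => absurd i.2 (by omega)) fun i _ => ?_, hc⟩
  rw [hc]; exact zero_le_one

lemma quadForm_pos {Γ : Matrix (Fin d) (Fin d) ℝ} (hΓ : Γ.PosDef) {x : Fin d → ℝ} (hx : x ≠ 0) :
    0 < quadForm Γ x := by
  have h := hΓ.dotProduct_mulVec_pos hx
  simpa [quadForm, dotProduct, Matrix.mulVec, Finset.mul_sum, mul_assoc] using h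

lemma IsUk.ne_zero {k : Fin d} {u : Fin d → ℝ} (hu : IsUk R k u) : u ≠ 0 := by
  intro h
  simpa [h] using hu.1

end LinearAlgebra

section BasicAdjointRelationship

variable {d : ℕ} {Γ R : Matrix (Fin d) (Fin d) ℝ} {r : ℝ}
  {π : Measure (Fin d → ℝ)} {ν : Fin d → Measure (Fin d → ℝ)}

/-- Probability measures on the orthant and on its faces satisfying the BAR. -/
structure IsStationary (Γ R : Matrix (Fin d) (Fin d) ℝ) (r : ℝ)
    (π : Measure (Fin d → ℝ)) (ν : Fin d → Measure (Fin d → ℝ)) : Prop where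
  r_mem : r ∈ Set.Ioo (0 : ℝ) 1
  prob : IsProbabilityMeasure π
  prob_face : ∀ i, IsProbabilityMeasure (ν i)
  ae_orthant : ∀ᵐ z ∂π, z ∈ posOrthant d
  ae_face : ∀ i, ∀ᵐ z ∂(ν i), z ∈ posOrthant d ∧ z i = 0
  bar : SatisfiesBAR Γ R r π ν

lemma isClosed_posOrthant : IsClosed (posOrthant d) := by
  have : posOrthant d = ⋂ i, {z | 0 ≤ z i} := by ext; simp [posOrthant]
  rw [this]
  exact isClosed_iInter fun i => isClosed_le continuous_const (continuous_apply i)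

lemma BARFamily.isStationary {π : ℝ → Measure (Fin d → ℝ)}
    {ν : Fin d → ℝ → Measure (Fin d → ℝ)} (h : BARFamily Γ R π ν) (hr : r ∈ Set.Ioo (0 : ℝ) 1) :
    IsStationary Γ R r (π r) (fun i => ν i r) := by
  obtain ⟨h1, h2, h3, h4⟩ := h r hr
  refine ⟨hr, h1, fun i => (h3 i).1, ?_, fun i => ?_, h4⟩
  · exact (mem_ae_iff_prob_eq_one isClosed_posOrthant.measurableSet).mpr h2
  · have := (h3 i).1
    refine (mem_ae_iff_prob_eq_one ?_).mpr (h3 i).2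
    exact isClosed_posOrthant.measurableSet.inter
      (isClosed_eq (continuous_apply i) continuous_const).measurableSet

lemma pd1_eq_of_hasDerivAt {f : (Fin d → ℝ) → ℝ} (hf : Differentiable ℝ f) {j : Fin d}
    {z : Fin d → ℝ} {a : ℝ}
    (h : HasDerivAt (fun t : ℝ => f (z + t • Pi.single j 1)) a 0) : pd1 f j z = a := by
  rw [pd1, ← (hf z).lineDeriv_eq_fderiv]
  exact h.deriv

/-- The BAR with the partial derivatives of the test function given explicitly. -/
lemma SatisfiesBAR.of_hasDerivAt (h : SatisfiesBAR Γ R r π ν) {f : (Fin d → ℝ) → ℝ}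
    (hf : ContDiff ℝ 2 f) {D : Fin d → (Fin d → ℝ) → ℝ} {H : Fin d → Fin d → (Fin d → ℝ) → ℝ}
    (hD : ∀ j z, HasDerivAt (fun t : ℝ => f (z + t • Pi.single j 1)) (D j z) 0)
    (hH : ∀ i j z, HasDerivAt (fun t : ℝ => D j (z + t • Pi.single i 1)) (H i j z) 0)
    {C : ℝ} (hC : ∀ z ∈ posOrthant d, |f z| ≤ C ∧ (∀ j, |D j z| ≤ C) ∧ (∀ i j, |H i j z| ≤ C)) :
    (1 / 2) * (∫ z, ∑ i, ∑ j, Γ i j * H i j z ∂π)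
      - (∑ i : Fin d, r ^ ((i : ℕ) + 1) * ∫ z, ∑ j, R j i * D j z ∂π)
      + (∑ i : Fin d, r ^ ((i : ℕ) + 1) * ∫ z, ∑ j, R j i * D j z ∂(ν i)) = 0 := by
  have h1 : ∀ j, pd1 f j = D j := fun j => funext fun z =>
    pd1_eq_of_hasDerivAt (hf.differentiable (by norm_num)) (hD j z)
  have hdiff : ∀ j, Differentiable ℝ (D j) := by
    intro j
    rw [← h1 j]
    have hfd : ContDiff ℝ 1 (fderiv ℝ f) := hf.fderiv_right (by norm_num)
    exact (hfd.clm_apply contDiff_const).differentiable (by norm_num)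
  have h2 : ∀ i j, pd2 f i j = H i j := fun i j => funext fun z => by
    have := pd1_eq_of_hasDerivAt (hdiff j) (hH i j z)
    rw [← this, pd2, h1 j, pd1]
  have := h f ⟨hf, C, by simpa only [h1, h2] using hC⟩
  simpa only [h1, h2] using this

/-- The Laplace transform of a measure on `ℝ^d`. -/
def laplace (μ : Measure (Fin d → ℝ)) (θ : Fin d → ℝ) : ℝ := ∫ z, Real.exp (-(θ ⬝ᵥ z)) ∂μ

lemma continuous_dotProduct_const (u : Fin d → ℝ) : Continuous fun z => u ⬝ᵥ z := by
  unfold dotProduct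
  fun_prop

lemma dotProduct_nonneg_of_mem {u z : Fin d → ℝ} (hu : 0 ≤ u) (hz : z ∈ posOrthant d) :
    0 ≤ u ⬝ᵥ z :=
  Finset.sum_nonneg fun i _ => mul_nonneg (hu i) (hz i)

lemma integrable_of_continuous {μ : Measure (Fin d → ℝ)} [IsFiniteMeasure μ]
    (hμ : ∀ᵐ z ∂μ, z ∈ posOrthant d) {f : (Fin d → ℝ) → ℝ} (hf : Continuous f) (C : ℝ)
    (hC : ∀ z ∈ posOrthant d, |f z| ≤ C) : Integrable f μ :=
  Integrable.of_bound hf.aestronglyMeasurable C (hμ.mono fun z hz => hC z hz)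

lemma IsStationary.laplace_bar (h : IsStationary Γ R r π ν) {θ : Fin d → ℝ} (hθ : 0 ≤ θ) :
    (1 / 2) * (quadForm Γ θ * laplace π θ)
      + ∑ i : Fin d, r ^ ((i : ℕ) + 1) * (uR R θ i * (laplace π θ - laplace (ν i) θ)) = 0 := by
  have hbase : ∀ (j : Fin d) (z : Fin d → ℝ), HasDerivAt
      (fun t : ℝ => Real.exp (-(θ ⬝ᵥ (z + t • Pi.single j 1))))
      (-θ j * Real.exp (-(θ ⬝ᵥ z))) 0 := by
    intro j z
    have : HasDerivAt (fun t : ℝ => -(θ ⬝ᵥ z + t * θ j)) (-θ j) 0 := by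
      simpa [-neg_add_rev] using
        (((hasDerivAt_id (0 : ℝ)).mul_const (θ j)).const_add (θ ⬝ᵥ z)).fun_neg
    have := this.exp
    simpa [dotProduct_add, dotProduct_smul, mul_comm] using this
  obtain ⟨C, hC⟩ : ∃ C : ℝ, 1 ≤ C ∧ (∀ j, θ j ≤ C) ∧ ∀ i j, θ i * θ j ≤ C := by
    have hs : ∀ j, θ j ≤ ∑ i, θ i := fun j =>
      Finset.single_le_sum (fun i _ => hθ i) (Finset.mem_univ j)
    have h0 : 0 ≤ ∑ i, θ i := Finset.sum_nonneg fun i _ => hθ i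
    refine ⟨(1 + ∑ i, θ i) ^ 2, by nlinarith, fun j => by nlinarith [hs j], fun i j => ?_⟩
    nlinarith [mul_le_mul (hs i) (hs j) (hθ j) h0]
  have key := h.bar.of_hasDerivAt (f := fun z => Real.exp (-(θ ⬝ᵥ z)))
    (D := fun j z => -θ j * Real.exp (-(θ ⬝ᵥ z)))
    (H := fun i j z => θ i * θ j * Real.exp (-(θ ⬝ᵥ z)))
    (by unfold dotProduct; fun_prop) hbase
    (fun i j z => ((hbase i z).const_mul (-θ j)).congr_deriv (by ring)) (C := C) (by
      intro z hz
      have he : Real.exp (-(θ ⬝ᵥ z)) ≤ 1 :=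
        Real.exp_le_one_iff.mpr (neg_nonpos.mpr (dotProduct_nonneg_of_mem hθ hz))
      have he0 := Real.exp_pos (-(θ ⬝ᵥ z))
      refine ⟨?_, fun j => ?_, fun i j => ?_⟩
      · rw [abs_of_pos he0]; linarith [hC.1]
      · rw [abs_mul, abs_neg, abs_of_pos he0, abs_of_nonneg (hθ j)]
        exact (mul_le_of_le_one_right (hθ j) he).trans (hC.2.1 j)
      · have hij := mul_nonneg (hθ i) (hθ j)
        rw [abs_mul, abs_of_pos he0, abs_of_nonneg hij]
        exact (mul_le_of_le_one_right hij he).trans (hC.2.2 i j))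
  have e1 : (∫ z, ∑ i, ∑ j, Γ i j * (θ i * θ j * Real.exp (-(θ ⬝ᵥ z))) ∂π)
      = quadForm Γ θ * laplace π θ := by
    rw [laplace, ← integral_const_mul]
    congr 1 with z
    simp only [quadForm, Finset.sum_mul]
    exact Finset.sum_congr rfl fun i _ => Finset.sum_congr rfl fun j _ => by ring
  have e2 : ∀ (μ : Measure (Fin d → ℝ)) (i : Fin d),
      (∫ z, ∑ j, R j i * (-θ j * Real.exp (-(θ ⬝ᵥ z))) ∂μ) = -(uR R θ i * laplace μ θ) := by
    intro μ i
    rw [laplace, ← integral_const_mul, ← integral_neg]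
    congr 1 with z
    simp only [uR, Finset.sum_mul, ← Finset.sum_neg_distrib]
    exact Finset.sum_congr rfl fun j _ => by ring
  rw [e1] at key
  simp only [e2] at key
  rw [sub_add, ← Finset.sum_sub_distrib, sub_eq_add_neg, ← Finset.sum_neg_distrib] at key
  rw [← key]
  congr 1
  exact Finset.sum_congr rfl fun i _ => by ring

end BasicAdjointRelationship

section RidgeIdentity

variable {d : ℕ} {Γ R : Matrix (Fin d) (Fin d) ℝ} {r : ℝ}
  {π : Measure (Fin d → ℝ)} {ν : Fin d → Measure (Fin d → ℝ)}

/-- The saturating function `1 - exp (-s ⟨u, z⟩)`. -/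
def sat (s : ℝ) (u z : Fin d → ℝ) : ℝ := 1 - Real.exp (-(s * (u ⬝ᵥ z)))

lemma continuous_sat (s : ℝ) (u : Fin d → ℝ) : Continuous (sat s u) := by
  have := continuous_dotProduct_const u
  unfold sat
  fun_prop

lemma sat_nonneg {s : ℝ} (hs : 0 ≤ s) {u z : Fin d → ℝ} (hu : 0 ≤ u) (hz : z ∈ posOrthant d) :
    0 ≤ sat s u z :=
  sub_nonneg.mpr (Real.exp_le_one_iff.mpr
    (neg_nonpos.mpr (mul_nonneg hs (dotProduct_nonneg_of_mem hu hz))))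

lemma sat_le_one (s : ℝ) (u z : Fin d → ℝ) : sat s u z ≤ 1 :=
  sub_le_self _ (Real.exp_pos _).le

lemma abs_sat_pow_le_one {s : ℝ} (hs : 0 ≤ s) {u z : Fin d → ℝ} (hu : 0 ≤ u)
    (hz : z ∈ posOrthant d) (p : ℕ) : |sat s u z ^ p| ≤ 1 := by
  rw [abs_of_nonneg (pow_nonneg (sat_nonneg hs hu hz) p)]
  exact pow_le_one₀ (sat_nonneg hs hu hz) (sat_le_one s u z)

lemma integrable_sat_pow {μ : Measure (Fin d → ℝ)} [IsFiniteMeasure μ]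
    (hμ : ∀ᵐ z ∂μ, z ∈ posOrthant d) {s : ℝ} (hs : 0 ≤ s) {u : Fin d → ℝ} (hu : 0 ≤ u) (p : ℕ) :
    Integrable (fun z => sat s u z ^ p) μ :=
  integrable_of_continuous hμ ((continuous_sat s u).pow p) 1
    fun _ hz => abs_sat_pow_le_one hs hu hz p

lemma integral_sat_pow_nonneg {μ : Measure (Fin d → ℝ)}
    (hμ : ∀ᵐ z ∂μ, z ∈ posOrthant d) {s : ℝ} (hs : 0 ≤ s) {u : Fin d → ℝ} (hu : 0 ≤ u) (p : ℕ) :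
    0 ≤ ∫ z, sat s u z ^ p ∂μ :=
  integral_nonneg_of_ae (hμ.mono fun _ hz => pow_nonneg (sat_nonneg hs hu hz) p)

lemma integral_sat_pow_le_one {μ : Measure (Fin d → ℝ)} [IsProbabilityMeasure μ]
    (hμ : ∀ᵐ z ∂μ, z ∈ posOrthant d) {s : ℝ} (hs : 0 ≤ s) {u : Fin d → ℝ} (hu : 0 ≤ u) (p : ℕ) :
    ∫ z, sat s u z ^ p ∂μ ≤ 1 := by
  calc ∫ z, sat s u z ^ p ∂μ ≤ ∫ _, (1 : ℝ) ∂μ :=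
        integral_mono_ae (integrable_sat_pow hμ hs hu p) (integrable_const _)
          (hμ.mono fun z hz => (le_abs_self _).trans (abs_sat_pow_le_one hs hu hz p))
    _ = 1 := by simp

lemma quadForm_smul (a : ℝ) (x : Fin d → ℝ) : quadForm Γ (a • x) = a ^ 2 * quadForm Γ x := by
  simp only [quadForm, Finset.mul_sum, Pi.smul_apply, smul_eq_mul]
  exact Finset.sum_congr rfl fun i _ => Finset.sum_congr rfl fun j _ => by ring

lemma IsStationary.ae_face_orthant (h : IsStationary Γ R r π ν) (i : Fin d) :
    ∀ᵐ z ∂(ν i), z ∈ posOrthant d := (h.ae_face i).mono fun _ hz => hz.1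

lemma integrable_polynomial_exp {μ : Measure (Fin d → ℝ)} [IsFiniteMeasure μ]
    (hμ : ∀ᵐ z ∂μ, z ∈ posOrthant d) {s : ℝ} (hs : 0 ≤ s) {u : Fin d → ℝ} (hu : 0 ≤ u)
    (P : Polynomial ℝ) : Integrable (fun z => P.eval (Real.exp (-(s * (u ⬝ᵥ z))))) μ := by
  obtain ⟨C, hC⟩ := isCompact_Icc.exists_bound_of_continuousOn
    (f := fun x => P.eval x) (s := Set.Icc (0 : ℝ) 1) P.continuous.continuousOn
  have := continuous_dotProduct_const u
  refine integrable_of_continuous hμ (P.continuous.comp (by fun_prop)) C fun z hz => hC _ ⟨?_, ?_⟩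
  · exact (Real.exp_pos _).le
  · exact Real.exp_le_one_iff.mpr
      (neg_nonpos.mpr (mul_nonneg hs (dotProduct_nonneg_of_mem hu hz)))

/-- The BAR for functions that are polynomials in `exp (-s ⟨u, z⟩)`. -/
lemma IsStationary.polynomial_bar (h : IsStationary Γ R r π ν) {s : ℝ} (hs : 0 < s)
    {u : Fin d → ℝ} (hu : 0 ≤ u) (P : Polynomial ℝ) :
    (1 / 2) * quadForm Γ u * s * ∫ z, (Polynomial.X * Polynomial.derivative P).eval
        (Real.exp (-(s * (u ⬝ᵥ z)))) ∂π
      = ∑ m : Fin d, r ^ ((m : ℕ) + 1) * (uR R u m *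
        ((∫ z, P.eval (Real.exp (-(s * (u ⬝ᵥ z)))) ∂(ν m))
          - ∫ z, P.eval (Real.exp (-(s * (u ⬝ᵥ z)))) ∂π)) := by
  have := h.prob
  have := h.prob_face
  have hπ := fun P => integrable_polynomial_exp h.ae_orthant hs.le hu P
  have hν := fun m P => integrable_polynomial_exp (h.ae_face_orthant m) hs.le hu P
  induction P using Polynomial.induction_on' with
  | add p q hp hq =>
    simp only [Polynomial.derivative_add, mul_add, Polynomial.eval_add] at hp hq ⊢
    rw [integral_add (hπ _) (hπ _), mul_add, hp, hq, ← Finset.sum_add_distrib]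
    refine Finset.sum_congr rfl fun m _ => ?_
    rw [integral_add (hπ _) (hπ _), integral_add (hν m _) (hν m _)]
    ring
  | monomial n a =>
    rcases Nat.eq_zero_or_pos n with rfl | hn
    · simp
    have hn' : (0 : ℝ) < n := by exact_mod_cast hn
    have hb := h.laplace_bar (θ := (n * s) • u) (fun i => mul_nonneg (by positivity) (hu i))
    have hpow : ∀ z : Fin d → ℝ, Real.exp (-(s * (u ⬝ᵥ z))) ^ n
        = Real.exp (-(((n * s) • u) ⬝ᵥ z)) := fun z => by
      rw [← Real.exp_nat_mul, smul_dotProduct, smul_eq_mul]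
      ring_nf
    have e1 : ∀ μ : Measure (Fin d → ℝ),
        ∫ z, (Polynomial.monomial n a).eval (Real.exp (-(s * (u ⬝ᵥ z)))) ∂μ
          = a * laplace μ ((n * s) • u) := fun μ => by
      simp only [Polynomial.eval_monomial, hpow, integral_const_mul, laplace]
    have e2 : (Polynomial.X * Polynomial.derivative (Polynomial.monomial n a) : Polynomial ℝ)
        = Polynomial.C (n : ℝ) * Polynomial.monomial n a := by
      rw [Polynomial.derivative_monomial, Polynomial.X_mul_monomial,
        Polynomial.C_mul_monomial, Nat.sub_add_cancel hn, mul_comm]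
    rw [e2]
    simp only [Polynomial.eval_C_mul, integral_const_mul, e1]
    rw [quadForm_smul] at hb
    simp only [uR_smul] at hb
    have hs0 : (n * s : ℝ) ≠ 0 := by positivity
    apply mul_left_cancel₀ hs0
    rw [Finset.mul_sum]
    have : ∑ m : Fin d, (n * s) * (r ^ ((m : ℕ) + 1) * (uR R u m *
        (a * laplace (ν m) ((n * s) • u) - a * laplace π ((n * s) • u))))
        = - a * ∑ i : Fin d, r ^ ((i : ℕ) + 1) * (n * s * uR R u i *
          (laplace π ((n * s) • u) - laplace (ν i) ((n * s) • u))) := by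
      rw [Finset.mul_sum]
      exact Finset.sum_congr rfl fun i _ => by ring
    rw [this]
    linear_combination a * hb

lemma IsStationary.sat_bar (h : IsStationary Γ R r π ν) {s : ℝ} (hs : 0 < s)
    {u : Fin d → ℝ} (hu : 0 ≤ u) (p : ℕ) :
    (1 / 2) * quadForm Γ u * s * ((p + 1) * ∫ z, (1 - sat s u z) * sat s u z ^ p ∂π)
      = ∑ m : Fin d, r ^ ((m : ℕ) + 1) * (uR R u m *
        ((∫ z, sat s u z ^ (p + 1) ∂π) - ∫ z, sat s u z ^ (p + 1) ∂(ν m))) := by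
  have key := h.polynomial_bar hs hu ((1 - Polynomial.X) ^ (p + 1))
  have e : ∀ x : ℝ, (Polynomial.X * Polynomial.derivative ((1 - Polynomial.X) ^ (p + 1) :
      Polynomial ℝ)).eval x = -((p + 1) * (x * (1 - x) ^ p)) := fun x => by
    simp [Polynomial.derivative_pow]
    ring
  simp only [e, Polynomial.eval_pow, Polynomial.eval_sub, Polynomial.eval_one,
    Polynomial.eval_X, integral_neg, integral_const_mul] at key
  have e' : ∀ z, Real.exp (-(s * (u ⬝ᵥ z))) = 1 - sat s u z := fun z => by simp [sat]
  simp only [e', sub_sub_cancel] at key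
  rw [mul_neg, neg_eq_iff_eq_neg, ← Finset.sum_neg_distrib] at key
  rw [key]
  exact Finset.sum_congr rfl fun i _ => by ring

end RidgeIdentity

section FaceBound

variable {d : ℕ} {Γ R : Matrix (Fin d) (Fin d) ℝ} {r : ℝ}
  {π : Measure (Fin d → ℝ)} {ν : Fin d → Measure (Fin d → ℝ)}

lemma hasDerivAt_exp_neg_coord (z : Fin d → ℝ) (i l : Fin d) :
    HasDerivAt (fun t : ℝ => Real.exp (-(z + t • (Pi.single i 1 : Fin d → ℝ)) l))
      (-((Pi.single i 1 : Fin d → ℝ) l * Real.exp (-z l))) 0 := by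
  have : HasDerivAt (fun t : ℝ => -(z l + t * (Pi.single i 1 : Fin d → ℝ) l))
      (-((Pi.single i 1 : Fin d → ℝ) l)) 0 := by
    simpa [-neg_add_rev] using
      (((hasDerivAt_id (0 : ℝ)).mul_const ((Pi.single i 1 : Fin d → ℝ) l)).const_add (z l)).fun_neg
  have := this.exp
  refine this.congr_deriv ?_
  simp [mul_comm]

/-- The function `∑ l, c l * (1 - exp (-z l))`. -/
def corner (c z : Fin d → ℝ) : ℝ := ∑ l, c l * (1 - Real.exp (-z l))

lemma hasDerivAt_corner (c z : Fin d → ℝ) (i : Fin d) :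
    HasDerivAt (fun t : ℝ => corner c (z + t • (Pi.single i 1 : Fin d → ℝ)))
      (c i * Real.exp (-z i)) 0 := by
  have := HasDerivAt.fun_sum (u := Finset.univ) fun l _ =>
    ((hasDerivAt_exp_neg_coord z i l).const_sub 1).const_mul (c l)
  refine this.congr_deriv ?_
  rw [Finset.sum_eq_single i]
  · simp
  · intro l _ hl; simp [Pi.single_eq_of_ne hl]
  · simp

lemma corner_nonneg {c z : Fin d → ℝ} (hc : 0 ≤ c) (hz : z ∈ posOrthant d) : 0 ≤ corner c z :=
  Finset.sum_nonneg fun l _ => mul_nonneg (hc l)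
    (sub_nonneg.mpr (Real.exp_le_one_iff.mpr (neg_nonpos.mpr (hz l))))

lemma corner_le {c : Fin d → ℝ} (hc : 0 ≤ c) (z : Fin d → ℝ) : corner c z ≤ ∑ l, c l :=
  Finset.sum_le_sum fun l _ => mul_le_of_le_one_right (hc l)
    (sub_le_self _ (Real.exp_pos _).le)

lemma hasDerivAt_comp_dotProduct {G : ℝ → ℝ} {G' : ℝ} (u z : Fin d → ℝ) (i : Fin d)
    (h : HasDerivAt G G' (u ⬝ᵥ z)) :
    HasDerivAt (fun t : ℝ => G (u ⬝ᵥ (z + t • (Pi.single i 1 : Fin d → ℝ)))) (G' * u i) 0 := by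
  have h2 : HasDerivAt (fun t : ℝ => u ⬝ᵥ (z + t • (Pi.single i 1 : Fin d → ℝ))) (u i) 0 := by
    simpa [dotProduct_add, dotProduct_smul] using
      ((hasDerivAt_id (0 : ℝ)).mul_const (u i)).const_add (u ⬝ᵥ z)
  have h' : HasDerivAt G G' (u ⬝ᵥ (z + (0 : ℝ) • (Pi.single i 1 : Fin d → ℝ))) := by simpa using h
  exact h'.comp (0 : ℝ) h2

lemma one_le_sum_corner_deriv {c z : Fin d → ℝ} (hR : IsMMatrix R) (hc : 0 ≤ c) {m : Fin d}
    (hcm : uR R c m = 1) (hz : z ∈ posOrthant d) (hzm : z m = 0) :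
    1 ≤ ∑ j, R j m * (c j * Real.exp (-z j)) := by
  rw [← hcm, uR]
  refine Finset.sum_le_sum fun j _ => ?_
  rcases eq_or_ne j m with rfl | hj
  · simp [hzm, mul_comm]
  · have h1 : c j * Real.exp (-z j) ≤ c j :=
      mul_le_of_le_one_right (hc j) (Real.exp_le_one_iff.mpr (neg_nonpos.mpr (hz j)))
    nlinarith [hR.1 j m hj]

/-- The constant in `IsStationary.sum_face_le`. -/
def faceConst (Γ R : Matrix (Fin d) (Fin d) ℝ) (c u : Fin d → ℝ) (A : ℝ) : ℝ :=
  2 * ((∑ i, ∑ j, |R j i| * ((∑ l, u l) * (∑ l, c l) + ∑ l, c l))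
    + (1 / 2) * ∑ i, ∑ j, |Γ i j| *
      (A * (∑ l, u l) ^ 2 * (∑ l, c l) + 2 * (∑ l, u l) * (∑ l, c l) + ∑ l, c l))

lemma faceConst_nonneg {c u : Fin d → ℝ} {A : ℝ} (hc : 0 ≤ c) (hu : 0 ≤ u) (hA : 0 ≤ A) :
    0 ≤ faceConst Γ R c u A := by
  have h1 : 0 ≤ ∑ l, c l := Finset.sum_nonneg fun l _ => hc l
  have h2 : 0 ≤ ∑ l, u l := Finset.sum_nonneg fun l _ => hu l
  unfold faceConst
  positivity

lemma IsStationary.sum_face_le (h : IsStationary Γ R r π ν) (hR : IsMMatrix R)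
    {c u : Fin d → ℝ} (hc : 0 ≤ c) (hcR : ∀ m, uR R c m = 1) (hu : 0 ≤ u)
    {G G1 G2 : ℝ → ℝ} (hG : ContDiff ℝ 2 G) (hG1 : ∀ y, HasDerivAt G (G1 y) y)
    (hG2 : ∀ y, HasDerivAt G1 (G2 y) y) {A B ε : ℝ} (hA : 0 ≤ A) (hε1 : ε ≤ 1)
    (hε : ∀ m, ε * (∑ l, c l) * |uR R u m| ≤ 1 / 2)
    (hG0 : ∀ y, 0 ≤ y → 0 ≤ G y) (hGB : ∀ y, 0 ≤ y → G y ≤ B)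
    (hG1b : ∀ y, 0 ≤ y → |G1 y| ≤ ε * G y) (hG2b : ∀ y, 0 ≤ y → |G2 y| ≤ A * G y) :
    ∑ m : Fin d, r ^ ((m : ℕ) + 1) * ∫ z, G (u ⬝ᵥ z) ∂(ν m)
      ≤ faceConst Γ R c u A * ∫ z, G (u ⬝ᵥ z) ∂π := by
  have := h.prob
  have := h.prob_face
  have hr0 : 0 < r := h.r_mem.1
  have hr1 : r < 1 := h.r_mem.2
  set S := ∑ l, c l with hS
  set U := ∑ l, u l with hU
  have hS0 : 0 ≤ S := Finset.sum_nonneg fun l _ => hc l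
  have hU0 : 0 ≤ U := Finset.sum_nonneg fun l _ => hu l
  have hcS : ∀ j, c j ≤ S := fun j => Finset.single_le_sum (fun i _ => hc i) (Finset.mem_univ j)
  have huU : ∀ j, u j ≤ U := fun j => Finset.single_le_sum (fun i _ => hu i) (Finset.mem_univ j)
  let D : Fin d → (Fin d → ℝ) → ℝ := fun j z =>
    G1 (u ⬝ᵥ z) * u j * corner c z + G (u ⬝ᵥ z) * (c j * Real.exp (-z j))
  let H : Fin d → Fin d → (Fin d → ℝ) → ℝ := fun i j z =>
    (G2 (u ⬝ᵥ z) * u i * u j * corner c z + G1 (u ⬝ᵥ z) * u j * (c i * Real.exp (-z i)))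
      + (G1 (u ⬝ᵥ z) * u i * (c j * Real.exp (-z j))
        + G (u ⬝ᵥ z) * (c j * -((Pi.single i 1 : Fin d → ℝ) j * Real.exp (-z j))))
  have hDb : ∀ z ∈ posOrthant d, ∀ j, |D j z| ≤ (U * S + S) * G (u ⬝ᵥ z) := by
    intro z hz j
    have hy := dotProduct_nonneg_of_mem hu hz
    have g0 := hG0 _ hy
    have g1 : |G1 (u ⬝ᵥ z)| ≤ G (u ⬝ᵥ z) := (hG1b _ hy).trans (mul_le_of_le_one_left g0 hε1)
    have e0 := (Real.exp_pos (-z j)).le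
    have e1 : Real.exp (-z j) ≤ 1 := Real.exp_le_one_iff.mpr (neg_nonpos.mpr (hz j))
    have k0 := corner_nonneg hc hz
    have k1 := corner_le hc z
    have a1 : |G1 (u ⬝ᵥ z) * u j * corner c z| ≤ G (u ⬝ᵥ z) * U * S := by
      rw [abs_mul, abs_mul, abs_of_nonneg (hu j), abs_of_nonneg k0]
      have := huU j
      have : 0 ≤ u j := hu j
      gcongr
    have a2 : |G (u ⬝ᵥ z) * (c j * Real.exp (-z j))| ≤ G (u ⬝ᵥ z) * (S * 1) := by
      have : 0 ≤ c j := hc j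
      rw [abs_of_nonneg (by positivity)]
      have := hcS j
      gcongr
    calc |D j z| ≤ _ := abs_add_le _ _
      _ ≤ _ := add_le_add a1 a2
      _ = _ := by ring
  have hHb : ∀ z ∈ posOrthant d, ∀ i j,
      |H i j z| ≤ (A * U ^ 2 * S + 2 * U * S + S) * G (u ⬝ᵥ z) := by
    intro z hz i j
    have hy := dotProduct_nonneg_of_mem hu hz
    have g0 := hG0 _ hy
    have g1 : |G1 (u ⬝ᵥ z)| ≤ G (u ⬝ᵥ z) := (hG1b _ hy).trans (mul_le_of_le_one_left g0 hε1)
    have g2 := hG2b _ hy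
    have e0 := fun l => (Real.exp_pos (-z l)).le
    have e1 : ∀ l, Real.exp (-z l) ≤ 1 := fun l =>
      Real.exp_le_one_iff.mpr (neg_nonpos.mpr (hz l))
    have k0 := corner_nonneg hc hz
    have k1 := corner_le hc z
    have a1 : |G2 (u ⬝ᵥ z) * u i * u j * corner c z| ≤ A * G (u ⬝ᵥ z) * U * U * S := by
      rw [abs_mul, abs_mul, abs_mul, abs_of_nonneg (hu i), abs_of_nonneg (hu j), abs_of_nonneg k0]
      have : 0 ≤ u i := hu i
      have : 0 ≤ u j := hu j
      have := huU i
      have := huU j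
      gcongr
    have a2 : ∀ i j, |G1 (u ⬝ᵥ z) * u j * (c i * Real.exp (-z i))|
        ≤ G (u ⬝ᵥ z) * U * (S * 1) := by
      intro i j
      have : 0 ≤ u j := hu j
      have : 0 ≤ c i := hc i
      rw [abs_mul, abs_mul, abs_of_nonneg (hu j), abs_of_nonneg (mul_nonneg (hc i) (e0 i))]
      have := huU j
      have := hcS i
      have := e1 i
      have := e0 i
      gcongr
    have a3 : |G (u ⬝ᵥ z) * (c j * -((Pi.single i 1 : Fin d → ℝ) j * Real.exp (-z j)))|
        ≤ G (u ⬝ᵥ z) * (S * (1 * 1)) := by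
      have : 0 ≤ c j := hc j
      have s0 : (0 : ℝ) ≤ (Pi.single i 1 : Fin d → ℝ) j := by
        rcases eq_or_ne j i with rfl | hj <;> simp [*]
      have s1 : (Pi.single i 1 : Fin d → ℝ) j ≤ (1 : ℝ) := by
        rcases eq_or_ne j i with rfl | hj <;> simp [*]
      have := e0 j
      rw [mul_neg, mul_neg, abs_neg, abs_of_nonneg (by positivity)]
      have := hcS j
      have := e1 j
      gcongr
    calc |H i j z| ≤ _ := abs_add_le _ _
      _ ≤ _ := add_le_add (abs_add_le _ _) (abs_add_le _ _)
      _ ≤ _ := add_le_add (add_le_add a1 (a2 i j)) (add_le_add (a2 j i) a3)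
      _ = _ := by ring
  have hB0 : ∀ z ∈ posOrthant d, G (u ⬝ᵥ z) ≤ |B| := fun z hz =>
    (hGB _ (dotProduct_nonneg_of_mem hu hz)).trans (le_abs_self B)
  have hfac := mul_nonneg hU0 hS0
  have hfac2 : 0 ≤ A * U ^ 2 * S + 2 * U * S + S := by positivity
  have cG : Continuous G := hG.continuous
  have cG1 : Continuous G1 := continuous_iff_continuousAt.mpr fun y => (hG2 y).continuousAt
  have cu := continuous_dotProduct_const u
  have ck : Continuous (corner c) := by unfold corner; fun_prop
  have hbase : ∀ i z, HasDerivAt (fun t : ℝ => G (u ⬝ᵥ (z + t • (Pi.single i 1 : Fin d → ℝ))))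
      (G1 (u ⬝ᵥ z) * u i) 0 := fun i z => hasDerivAt_comp_dotProduct u z i (hG1 _)
  have hbase1 : ∀ i z, HasDerivAt (fun t : ℝ => G1 (u ⬝ᵥ (z + t • (Pi.single i 1 : Fin d → ℝ))))
      (G2 (u ⬝ᵥ z) * u i) 0 := fun i z => hasDerivAt_comp_dotProduct u z i (hG2 _)
  have key := h.bar.of_hasDerivAt (f := fun z => G (u ⬝ᵥ z) * corner c z) (D := D) (H := H)
    (by
      refine (hG.comp ?_).mul ?_
      · unfold dotProduct; fun_prop
      · unfold corner; fun_prop)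
    (fun j z => ((hbase j z).mul (hasDerivAt_corner c z j)).congr_deriv (by simp [D]))
    (fun i j z => ((((hbase1 i z).mul_const (u j)).mul (hasDerivAt_corner c z i)).add
      ((hbase i z).mul ((hasDerivAt_exp_neg_coord z i j).const_mul (c j)))).congr_deriv
        (by simp [H]))
    (C := S * |B| + (U * S + S) * |B| + (A * U ^ 2 * S + 2 * U * S + S) * |B|) (by
      intro z hz
      have hy := dotProduct_nonneg_of_mem hu hz
      have b0 := hB0 z hz
      have p1 : 0 ≤ S * |B| := by positivity
      have p2 : 0 ≤ (U * S + S) * |B| := by positivity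
      have p3 := mul_nonneg hfac2 (abs_nonneg B)
      refine ⟨?_, fun j => ?_, fun i j => ?_⟩
      · have k0 := corner_nonneg hc hz
        rw [abs_of_nonneg (mul_nonneg (hG0 _ hy) k0)]
        have : G (u ⬝ᵥ z) * corner c z ≤ |B| * S :=
          mul_le_mul b0 (corner_le hc z) k0 (abs_nonneg B)
        linarith
      · have := mul_le_mul_of_nonneg_left b0 (add_nonneg hfac hS0)
        linarith [hDb z hz j]
      · have := mul_le_mul_of_nonneg_left b0 hfac2
        linarith [hHb z hz i j])
  have cD : ∀ j, Continuous (D j) := fun j => by simp only [D]; fun_prop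
  have iG : ∀ (μ : Measure (Fin d → ℝ)) [IsFiniteMeasure μ], (∀ᵐ z ∂μ, z ∈ posOrthant d) →
      Integrable (fun z => G (u ⬝ᵥ z)) μ := fun μ _ hμ =>
    integrable_of_continuous hμ (cG.comp cu) |B| fun z hz => by
      rw [abs_of_nonneg (hG0 _ (dotProduct_nonneg_of_mem hu hz))]
      exact hB0 z hz
  have hpi1 : ∀ m, |∫ z, ∑ j, R j m * D j z ∂π|
      ≤ (∑ j, |R j m| * (U * S + S)) * ∫ z, G (u ⬝ᵥ z) ∂π := by
    intro m
    rw [← integral_const_mul, ← Real.norm_eq_abs]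
    refine norm_integral_le_of_norm_le ((iG π h.ae_orthant).const_mul _)
      (h.ae_orthant.mono fun z hz => ?_)
    rw [Real.norm_eq_abs, Finset.sum_mul]
    refine (Finset.abs_sum_le_sum_abs _ _).trans (Finset.sum_le_sum fun j _ => ?_)
    rw [abs_mul, mul_assoc]
    exact mul_le_mul_of_nonneg_left (hDb z hz j) (abs_nonneg _)
  have hpi2 : |∫ z, ∑ i, ∑ j, Γ i j * H i j z ∂π|
      ≤ (∑ i, ∑ j, |Γ i j| * (A * U ^ 2 * S + 2 * U * S + S)) * ∫ z, G (u ⬝ᵥ z) ∂π := by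
    rw [← integral_const_mul, ← Real.norm_eq_abs]
    refine norm_integral_le_of_norm_le ((iG π h.ae_orthant).const_mul _)
      (h.ae_orthant.mono fun z hz => ?_)
    rw [Real.norm_eq_abs, Finset.sum_mul]
    refine (Finset.abs_sum_le_sum_abs _ _).trans (Finset.sum_le_sum fun i _ => ?_)
    rw [Finset.sum_mul]
    refine (Finset.abs_sum_le_sum_abs _ _).trans (Finset.sum_le_sum fun j _ => ?_)
    rw [abs_mul, mul_assoc]
    exact mul_le_mul_of_nonneg_left (hHb z hz i j) (abs_nonneg _)
  have hface : ∀ m, (1 / 2) * ∫ z, G (u ⬝ᵥ z) ∂(ν m) ≤ ∫ z, ∑ j, R j m * D j z ∂(ν m) := by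
    intro m
    rw [← integral_const_mul]
    refine integral_mono_ae ((iG _ (h.ae_face_orthant m)).const_mul _)
      (integrable_of_continuous (h.ae_face_orthant m) (by fun_prop)
        (∑ j, |R j m| * ((U * S + S) * |B|)) fun z hz => ?_) ((h.ae_face m).mono fun z hz => ?_)
    · refine (Finset.abs_sum_le_sum_abs _ _).trans (Finset.sum_le_sum fun j _ => ?_)
      rw [abs_mul]
      refine mul_le_mul_of_nonneg_left ((hDb z hz j).trans ?_) (abs_nonneg _)
      exact mul_le_mul_of_nonneg_left (hB0 z hz) (by positivity)
    · have hy := dotProduct_nonneg_of_mem hu hz.1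
      have g0 := hG0 _ hy
      have k0 := corner_nonneg hc hz.1
      have e : ∑ j, R j m * D j z = G1 (u ⬝ᵥ z) * corner c z * uR R u m
          + G (u ⬝ᵥ z) * ∑ j, R j m * (c j * Real.exp (-z j)) := by
        simp only [D, uR, Finset.mul_sum, ← Finset.sum_add_distrib]
        exact Finset.sum_congr rfl fun j _ => by ring
      have l1 : |G1 (u ⬝ᵥ z) * corner c z * uR R u m| ≤ (1 / 2) * G (u ⬝ᵥ z) := by
        rw [abs_mul, abs_mul, abs_of_nonneg k0]
        calc |G1 (u ⬝ᵥ z)| * corner c z * |uR R u m|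
            ≤ (ε * G (u ⬝ᵥ z)) * S * |uR R u m| := by
              have := hG1b _ hy
              have := corner_le hc z
              have : 0 ≤ ε * G (u ⬝ᵥ z) := (abs_nonneg _).trans (hG1b _ hy)
              gcongr
          _ = (ε * S * |uR R u m|) * G (u ⬝ᵥ z) := by ring
          _ ≤ _ := mul_le_mul_of_nonneg_right (hε m) g0
      have l2 := mul_le_mul_of_nonneg_left (one_le_sum_corner_deriv hR hc (hcR m) hz.1 hz.2) g0
      have l3 := neg_abs_le (G1 (u ⬝ᵥ z) * corner c z * uR R u m)
      beta_reduce
      rw [e]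
      linarith
  have hI0 : 0 ≤ ∫ z, G (u ⬝ᵥ z) ∂π :=
    integral_nonneg_of_ae (h.ae_orthant.mono fun z hz => hG0 _ (dotProduct_nonneg_of_mem hu hz))
  have s1 : (1 / 2) * ∑ m : Fin d, r ^ ((m : ℕ) + 1) * ∫ z, G (u ⬝ᵥ z) ∂(ν m)
      ≤ ∑ m : Fin d, r ^ ((m : ℕ) + 1) * ∫ z, ∑ j, R j m * D j z ∂(ν m) := by
    rw [Finset.mul_sum]
    refine Finset.sum_le_sum fun m _ => ?_
    have := mul_le_mul_of_nonneg_left (hface m) (pow_nonneg hr0.le ((m : ℕ) + 1))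
    linarith
  have s2 : ∑ m : Fin d, r ^ ((m : ℕ) + 1) * ∫ z, ∑ j, R j m * D j z ∂π
      ≤ (∑ m, ∑ j, |R j m| * (U * S + S)) * ∫ z, G (u ⬝ᵥ z) ∂π := by
    rw [Finset.sum_mul]
    refine Finset.sum_le_sum fun m _ => ?_
    refine (mul_le_mul_of_nonneg_left ((le_abs_self _).trans (hpi1 m)) (by positivity)).trans ?_
    exact mul_le_of_le_one_left (by positivity) (pow_le_one₀ hr0.le hr1.le)
  have s3 := (neg_abs_le _).trans' (neg_le_neg hpi2)
  unfold faceConst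
  rw [← hS, ← hU]
  linarith

end FaceBound

section FaceMoment

variable {d : ℕ} {Γ R : Matrix (Fin d) (Fin d) ℝ} {r : ℝ}
  {π : Measure (Fin d → ℝ)} {ν : Fin d → Measure (Fin d → ℝ)}

/-- A bound of the face measures by the interior measure, uniform in all stationary pairs. -/
lemma exists_face_bound (Γ : Matrix (Fin d) (Fin d) ℝ) (hR : IsMMatrix R)
    {v : Fin d → Fin d → ℝ} (hv : ∀ k, IsUk R k (v k))
    {u : Fin d → ℝ} (hu : 0 ≤ u) (n : ℕ) :
    ∃ C : ℝ, 0 ≤ C ∧ ∀ (r : ℝ) (π : Measure (Fin d → ℝ)) (ν : Fin d → Measure (Fin d → ℝ)),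
      IsStationary Γ R r π ν → ∀ s : ℝ, 0 ≤ s → s ≤ 1 → ∀ m : Fin d,
        r ^ ((m : ℕ) + 1) * ∫ z, sat s u z ^ (n + 2) ∂(ν m)
          ≤ C * (s ^ (n + 2) + ∫ z, sat s u z ^ (n + 2) ∂π) := by
  obtain ⟨c, hc, hcR⟩ := exists_uR_eq_one hR hv
  have hS0 : 0 ≤ ∑ l, c l := Finset.sum_nonneg fun l _ => hc l
  set S := ∑ l, c l with hS
  set T := ∑ m, |uR R u m| with hT
  have hT0 : 0 ≤ T := Finset.sum_nonneg fun m _ => abs_nonneg _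
  have hTm : ∀ m, |uR R u m| ≤ T := fun m =>
    Finset.single_le_sum (f := fun m => |uR R u m|) (fun i _ => abs_nonneg _) (Finset.mem_univ m)
  set N : ℝ := n + 2 with hN
  have hN0 : 0 < N := by positivity
  have hN1 : 1 ≤ N := by rw [hN]; linarith [(Nat.cast_nonneg n : (0 : ℝ) ≤ n)]
  set K : ℝ := N * (1 + 2 * S * T) with hK
  have hST : 0 ≤ S * T := mul_nonneg hS0 hT0
  have hK1 : 1 ≤ K := by rw [hK]; nlinarith
  have hK0 : 0 < K := by linarith
  have hNK : N / K = 1 / (1 + 2 * S * T) := by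
    rw [hK]; field_simp
  have hA0 : 0 ≤ N ^ 2 := sq_nonneg N
  have hF := faceConst_nonneg (Γ := Γ) (R := R) hc hu hA0
  refine ⟨faceConst Γ R c u (N ^ 2) * (2 ^ (n + 1) * K ^ (n + 2)), by positivity, ?_⟩
  intro r π ν h s hs0 hs1 m
  have := h.prob
  have := h.prob_face
  have hr0 : 0 < r := h.r_mem.1
  have hexp : ∀ y : ℝ, HasDerivAt (fun y => Real.exp (-(s * y))) (-s * Real.exp (-(s * y))) y := by
    intro y
    have : HasDerivAt (fun y : ℝ => -(s * y)) (-s) y := by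
      simpa using ((hasDerivAt_id y).const_mul s).fun_neg
    exact this.exp.congr_deriv (by ring)
  have hg : ∀ y : ℝ, HasDerivAt (fun y => K * s + (1 - Real.exp (-(s * y))))
      (s * Real.exp (-(s * y))) y := fun y =>
    (((hexp y).const_sub 1).const_add (K * s)).congr_deriv (by ring)
  have hg0 : ∀ y, 0 ≤ y → K * s ≤ K * s + (1 - Real.exp (-(s * y))) := fun y hy => by
    have : Real.exp (-(s * y)) ≤ 1 :=
      Real.exp_le_one_iff.mpr (neg_nonpos.mpr (mul_nonneg hs0 hy))
    linarith
  have he1 : ∀ y, 0 ≤ y → Real.exp (-(s * y)) ≤ 1 := fun y hy =>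
    Real.exp_le_one_iff.mpr (neg_nonpos.mpr (mul_nonneg hs0 hy))
  have hKs : 0 ≤ K * s := by positivity
  have key := h.sum_face_le hR hc hcR hu
    (G := fun y => (K * s + (1 - Real.exp (-(s * y)))) ^ (n + 2))
    (G1 := fun y => N * (K * s + (1 - Real.exp (-(s * y)))) ^ (n + 1) * (s * Real.exp (-(s * y))))
    (G2 := fun y => N * ((n + 1) * (K * s + (1 - Real.exp (-(s * y)))) ^ n
        * (s * Real.exp (-(s * y)))) * (s * Real.exp (-(s * y)))
      + N * (K * s + (1 - Real.exp (-(s * y)))) ^ (n + 1) * (s * (-s * Real.exp (-(s * y)))))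
    (by fun_prop)
    (fun y => ((hg y).fun_pow (n + 2)).congr_deriv (by push_cast; simp [hN]))
    (fun y => ((((hg y).fun_pow (n + 1)).const_mul N).mul ((hexp y).const_mul s)).congr_deriv
      (by push_cast; simp))
    (A := N ^ 2) (B := (K + 1) ^ (n + 2)) (ε := N / K) hA0
    (by rw [hNK, div_le_one (by linarith)]; linarith)
    (fun m => by
      rw [hNK, ← hS, mul_assoc, one_div, inv_mul_le_iff₀ (by linarith)]
      nlinarith [mul_le_mul_of_nonneg_left (hTm m) hS0])
    (fun y hy => pow_nonneg (hKs.trans (hg0 y hy)) _)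
    (fun y hy => by
      refine pow_le_pow_left₀ (hKs.trans (hg0 y hy)) ?_ _
      have := (Real.exp_pos (-(s * y))).le
      nlinarith)
    (fun y hy => by
      have h1 := hg0 y hy
      have h2 := he1 y hy
      have h3 := (Real.exp_pos (-(s * y))).le
      set g := K * s + (1 - Real.exp (-(s * y))) with hgdef
      have hg' : 0 ≤ g := hKs.trans h1
      rw [abs_of_nonneg (by positivity), div_mul_eq_mul_div, le_div_iff₀ hK0, pow_succ g (n + 1)]
      calc N * g ^ (n + 1) * (s * Real.exp (-(s * y))) * K
          = N * g ^ (n + 1) * (K * s) * Real.exp (-(s * y)) := by ring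
        _ ≤ N * g ^ (n + 1) * g * 1 := by gcongr
        _ = _ := by ring)
    (fun y hy => by
      have h1 := hg0 y hy
      have h2 := he1 y hy
      have h3 := (Real.exp_pos (-(s * y))).le
      set g := K * s + (1 - Real.exp (-(s * y))) with hgdef
      have hg' : 0 ≤ g := hKs.trans h1
      have hsg : s ≤ g := by nlinarith
      set e := Real.exp (-(s * y))
      have a1 : |N * ((n + 1) * g ^ n * (s * e)) * (s * e)|
          ≤ N * ((n + 1) * g ^ n * (g * 1)) * (g * 1) := by
        rw [abs_of_nonneg (by positivity)]
        gcongr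
      have a2 : |N * g ^ (n + 1) * (s * (-s * e))| ≤ N * g ^ (n + 1) * (1 * (g * 1)) := by
        rw [neg_mul, mul_neg, mul_neg, abs_neg, abs_of_nonneg (by positivity)]
        gcongr
      refine (abs_add_le _ _).trans ((add_le_add a1 a2).trans (le_of_eq ?_))
      rw [hN]
      ring)
  have hle : ∀ (μ : Measure (Fin d → ℝ)) [IsProbabilityMeasure μ], (∀ᵐ z ∂μ, z ∈ posOrthant d) →
      Integrable (fun z => (K * s + sat s u z) ^ (n + 2)) μ := fun μ _ hμ => by
    have := continuous_sat s u
    refine integrable_of_continuous hμ (by fun_prop) ((K * s + 1) ^ (n + 2)) fun z hz => ?_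
    have h0 := sat_nonneg hs0 hu hz
    rw [abs_of_nonneg (by positivity)]
    have := sat_le_one s u z
    gcongr
  have hl : ∫ z, sat s u z ^ (n + 2) ∂(ν m) ≤ ∫ z, (K * s + sat s u z) ^ (n + 2) ∂(ν m) := by
    refine integral_mono_ae (integrable_sat_pow (h.ae_face_orthant m) hs0 hu _)
      (hle _ (h.ae_face_orthant m)) ((h.ae_face_orthant m).mono fun z hz => ?_)
    have h0 := sat_nonneg hs0 hu hz
    dsimp only
    gcongr
    linarith
  have hr : ∫ z, (K * s + sat s u z) ^ (n + 2) ∂π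
      ≤ 2 ^ (n + 1) * K ^ (n + 2) * (s ^ (n + 2) + ∫ z, sat s u z ^ (n + 2) ∂π) := by
    have e : s ^ (n + 2) + ∫ z, sat s u z ^ (n + 2) ∂π
        = ∫ z, (s ^ (n + 2) + sat s u z ^ (n + 2)) ∂π := by
      rw [integral_add (integrable_const _) (integrable_sat_pow h.ae_orthant hs0 hu _)]
      simp
    rw [e, ← integral_const_mul]
    refine integral_mono_ae (hle _ h.ae_orthant)
      (((integrable_const _).add (integrable_sat_pow h.ae_orthant hs0 hu _)).const_mul _)
      (h.ae_orthant.mono fun z hz => ?_)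
    have h0 := sat_nonneg hs0 hu hz
    have hp := add_pow_le hKs h0 (n + 2)
    have : (K * s) ^ (n + 2) + sat s u z ^ (n + 2)
        ≤ K ^ (n + 2) * (s ^ (n + 2) + sat s u z ^ (n + 2)) := by
      rw [mul_pow, mul_add]
      gcongr
      exact le_mul_of_one_le_left (by positivity) (one_le_pow₀ hK1)
    calc (K * s + sat s u z) ^ (n + 2) ≤ _ := hp
      _ ≤ 2 ^ (n + 1) * (K ^ (n + 2) * (s ^ (n + 2) + sat s u z ^ (n + 2))) := by
        rw [Nat.add_sub_assoc (by norm_num) n]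
        gcongr
      _ = _ := by ring
  have e3 : ∀ z, K * s + (1 - Real.exp (-(s * (u ⬝ᵥ z)))) = K * s + sat s u z := fun z => rfl
  simp only [e3] at key
  have hs : r ^ ((m : ℕ) + 1) * ∫ z, (K * s + sat s u z) ^ (n + 2) ∂(ν m)
      ≤ ∑ m : Fin d, r ^ ((m : ℕ) + 1) * ∫ z, (K * s + sat s u z) ^ (n + 2) ∂(ν m) := by
    refine Finset.single_le_sum (f := fun m : Fin d => r ^ ((m : ℕ) + 1) *
      ∫ z, (K * s + sat s u z) ^ (n + 2) ∂(ν m)) (fun i _ => ?_) (Finset.mem_univ m)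
    refine mul_nonneg (by positivity) (integral_nonneg_of_ae ((h.ae_face_orthant i).mono
      fun z hz => ?_))
    have h0 := sat_nonneg hs0 hu hz
    simp only [Pi.zero_apply]
    positivity
  calc r ^ ((m : ℕ) + 1) * ∫ z, sat s u z ^ (n + 2) ∂(ν m)
      ≤ r ^ ((m : ℕ) + 1) * ∫ z, (K * s + sat s u z) ^ (n + 2) ∂(ν m) := by gcongr
    _ ≤ faceConst Γ R c u (N ^ 2) * ∫ z, (K * s + sat s u z) ^ (n + 2) ∂π := hs.trans key
    _ ≤ faceConst Γ R c u (N ^ 2) * (2 ^ (n + 1) * K ^ (n + 2)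
        * (s ^ (n + 2) + ∫ z, sat s u z ^ (n + 2) ∂π)) := by gcongr
    _ = _ := by ring

end FaceMoment

section MomentBounds

variable {d : ℕ} {Γ R : Matrix (Fin d) (Fin d) ℝ}
  {π : ℝ → Measure (Fin d → ℝ)} {ν : Fin d → ℝ → Measure (Fin d → ℝ)}

/-- Under `π r`, the coordinates with index below `k` are of order `r ^ (-k)`, in the sense of
saturated moments. -/
def MomentBound (π : ℝ → Measure (Fin d → ℝ)) (k : ℕ) : Prop :=
  ∀ w : Fin d → ℝ, 0 ≤ w → (∀ i : Fin d, k ≤ i → w i = 0) → ∀ p : ℕ, ∃ C : ℝ, 0 ≤ C ∧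
    ∀ᶠ r in nhdsWithin (0 : ℝ) (Set.Ioo 0 1), ∀ s : ℝ, 0 < s →
      ∫ z, sat s w z ^ p ∂(π r) ≤ C * (s / r ^ k) ^ p

lemma BARFamily.eventually (h : BARFamily Γ R π ν) :
    ∀ᶠ r in nhdsWithin (0 : ℝ) (Set.Ioo 0 1), IsStationary Γ R r (π r) (fun i => ν i r) :=
  eventually_mem_nhdsWithin.mono fun _ hr => h.isStationary hr

lemma IsUk.sub_single_nonneg (hR : IsMMatrix R) {u : Fin d → Fin d → ℝ}
    (hu : ∀ k, IsUk R k (u k)) (j : Fin d) : 0 ≤ u j - Pi.single j 1 := by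
  intro i
  rcases eq_or_ne i j with rfl | hi
  · simp [(hu i).1]
  · simpa [hi] using IsUk.nonneg hR hu j i

lemma IsUk.sub_single_eq_zero {j : Fin d} {u : Fin d → ℝ} (hu : IsUk R j u) (i : Fin d)
    (hi : (j : ℕ) ≤ i) : (u - Pi.single j 1 : Fin d → ℝ) i = 0 := by
  rcases eq_or_lt_of_le (show j ≤ i from hi) with rfl | hlt
  · simp [hu.1]
  · simp [hlt.ne', hu.2.1 i hlt]

lemma sat_sub_single (s : ℝ) (u : Fin d → ℝ) {z : Fin d → ℝ} {j : Fin d} (hz : z j = 0) :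
    sat s (u - Pi.single j 1) z = sat s u z := by
  simp [sat, sub_dotProduct, hz]

lemma MomentBound.zero (h : BARFamily Γ R π ν) : MomentBound π 0 := by
  intro w _ hw p
  refine ⟨1, zero_le_one, h.eventually.mono fun r hr s hs => ?_⟩
  have := hr.prob
  have : w = 0 := funext fun i => hw i (Nat.zero_le _)
  rcases Nat.eq_zero_or_pos p with rfl | hp
  · simp
  · simp [this, sat, hp.ne']
    positivity

lemma MomentBound.face (hR : IsMMatrix R) (h : BARFamily Γ R π ν)
    {u : Fin d → Fin d → ℝ} (hu : ∀ k, IsUk R k (u k)) {j : Fin d} (hM : MomentBound π j)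
    (n : ℕ) : ∃ C : ℝ, 0 ≤ C ∧ ∀ᶠ r in nhdsWithin (0 : ℝ) (Set.Ioo 0 1), ∀ s : ℝ, 0 < s → s ≤ 1 →
      r ^ ((j : ℕ) + 1) * ∫ z, sat s (u j) z ^ (n + 2) ∂(ν j r)
        ≤ C * (s / r ^ (j : ℕ)) ^ (n + 2) := by
  have hw := IsUk.sub_single_nonneg hR hu j
  obtain ⟨C1, hC1, h1⟩ := exists_face_bound Γ hR hu hw n
  obtain ⟨C2, hC2, h2⟩ := hM _ hw (hu j).sub_single_eq_zero (n + 2)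
  refine ⟨C1 * (1 + C2), by positivity, ?_⟩
  filter_upwards [h.eventually, h2] with r hr hr2 s hs hs1
  have hr0 : 0 < r := hr.r_mem.1
  have e : ∫ z, sat s (u j) z ^ (n + 2) ∂(ν j r)
      = ∫ z, sat s (u j - Pi.single j 1) z ^ (n + 2) ∂(ν j r) :=
    integral_congr_ae ((hr.ae_face j).mono fun z hz => by
      dsimp only
      rw [sat_sub_single s (u j) hz.2])
  rw [e]
  refine (h1 r _ _ hr s hs.le hs1 j).trans ?_
  have hs2 : s ≤ s / r ^ (j : ℕ) :=
    le_div_self hs.le (by positivity) (pow_le_one₀ hr0.le hr.r_mem.2.le)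
  have hs3 := pow_le_pow_left₀ hs.le hs2 (n + 2)
  have := hr2 s hs
  rw [mul_assoc]
  refine mul_le_mul_of_nonneg_left ?_ hC1
  linarith

lemma pow_mul_pow_le_add {x t : ℝ} (hx : 0 ≤ x) (ht : 0 ≤ t) (p n : ℕ) :
    x ^ p * t ^ n ≤ t ^ (p + n) + x ^ (p + n) := by
  rw [pow_add, pow_add]
  rcases le_total x t with hxt | hxt
  · have := mul_le_mul_of_nonneg_right (pow_le_pow_left₀ hx hxt p) (pow_nonneg ht n)
    have : 0 ≤ x ^ p * x ^ n := by positivity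
    linarith
  · have := mul_le_mul_of_nonneg_left (pow_le_pow_left₀ ht hxt n) (pow_nonneg hx p)
    have : 0 ≤ t ^ p * t ^ n := by positivity
    linarith

/-- A high saturated moment controls a low one. -/
lemma integral_sat_pow_mul_le {μ : Measure (Fin d → ℝ)} [IsProbabilityMeasure μ]
    (hμ : ∀ᵐ z ∂μ, z ∈ posOrthant d) {s : ℝ} (hs : 0 ≤ s) {u : Fin d → ℝ} (hu : 0 ≤ u) {t : ℝ}
    (ht : 0 ≤ t) (p n : ℕ) :
    (∫ z, sat s u z ^ p ∂μ) * t ^ n ≤ t ^ (p + n) + ∫ z, sat s u z ^ (p + n) ∂μ := by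
  have e : t ^ (p + n) + ∫ z, sat s u z ^ (p + n) ∂μ
      = ∫ z, (t ^ (p + n) + sat s u z ^ (p + n)) ∂μ := by
    rw [integral_add (integrable_const _) (integrable_sat_pow hμ hs hu _)]
    simp
  rw [e, ← integral_mul_const]
  exact integral_mono_ae ((integrable_sat_pow hμ hs hu p).mul_const _)
    ((integrable_const _).add (integrable_sat_pow hμ hs hu _))
    (hμ.mono fun z hz => pow_mul_pow_le_add (sat_nonneg hs hu hz) ht p n)

lemma MomentBound.face_scaled (hR : IsMMatrix R) (h : BARFamily Γ R π ν)
    {u : Fin d → Fin d → ℝ} (hu : ∀ k, IsUk R k (u k)) {j : Fin d} (hM : MomentBound π j)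
    (p : ℕ) : ∃ C : ℝ, 0 ≤ C ∧ ∀ᶠ r in nhdsWithin (0 : ℝ) (Set.Ioo 0 1), ∀ s : ℝ, 0 < s →
      s ≤ r ^ ((j : ℕ) + 1) →
        ∫ z, sat s (u j) z ^ p ∂(ν j r) ≤ C * (s / r ^ ((j : ℕ) + 1)) ^ p := by
  obtain ⟨C, hC, hface⟩ := hM.face hR h hu (p + j)
  refine ⟨1 + C, by positivity, ?_⟩
  filter_upwards [h.eventually, hface] with r hr hr2 s hs hsr
  have := hr.prob_face j
  have hr0 : 0 < r := hr.r_mem.1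
  have hr1 := hr.r_mem.2.le
  have hσ : 0 < r ^ ((j : ℕ) + 1) := by positivity
  have hs1 : s ≤ 1 := hsr.trans (pow_le_one₀ hr0.le hr1)
  set t := s / r ^ ((j : ℕ) + 1) with ht
  have ht0 : 0 < t := by positivity
  have e1 : s / r ^ (j : ℕ) = t * r := by
    rw [ht, pow_succ]; field_simp
  have h3 := hr2 s hs hs1
  rw [e1, mul_pow] at h3
  have h4 : r ^ (p + j + 2) ≤ r ^ ((j : ℕ) + 1) := pow_le_pow_of_le_one hr0.le hr1 (by omega)
  have h5 : ∫ z, sat s (u j) z ^ (p + j + 2) ∂(ν j r) ≤ C * t ^ (p + j + 2) := by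
    refine le_of_mul_le_mul_left ?_ hσ
    calc _ ≤ _ := h3
      _ ≤ C * (t ^ (p + j + 2) * r ^ ((j : ℕ) + 1)) := by gcongr
      _ = _ := by ring
  have h6 := integral_sat_pow_mul_le (hr.ae_face_orthant j) hs.le (IsUk.nonneg hR hu j) ht0.le
    p (j + 2)
  refine le_of_mul_le_mul_right (h6.trans ?_) (pow_pos ht0 (j + 2))
  rw [← add_assoc]
  calc _ ≤ t ^ (p + j + 2) + C * t ^ (p + j + 2) := by gcongr
    _ = _ := by ring

lemma IsStationary.sat_recursion {r : ℝ} {π : Measure (Fin d → ℝ)}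
    {ν : Fin d → Measure (Fin d → ℝ)} (h : IsStationary Γ R r π ν)
    (hR : IsMMatrix R) {u : Fin d → Fin d → ℝ} (hu : ∀ k, IsUk R k (u k)) (j : Fin d)
    (hr : r * ∑ m, |uR R (u j) m| ≤ uR R (u j) j / 2) {s : ℝ} (hs : 0 < s) (p : ℕ) :
    (uR R (u j) j / 2) * ∫ z, sat s (u j) z ^ (p + 1) ∂π
      ≤ (1 / 2) * |quadForm Γ (u j)| * (s / r ^ ((j : ℕ) + 1)) * (p + 1)
          * (∫ z, sat s (u j) z ^ p ∂π)
        + uR R (u j) j * ∫ z, sat s (u j) z ^ (p + 1) ∂(ν j) := by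
  have := h.prob
  have := h.prob_face
  have hr0 : 0 < r := h.r_mem.1
  have hu0 := IsUk.nonneg hR hu j
  have hσ : 0 < r ^ ((j : ℕ) + 1) := by positivity
  have key := h.sat_bar hs hu0 p
  set I := ∫ z, sat s (u j) z ^ (p + 1) ∂π with hI
  have hI0 : 0 ≤ I := integral_sat_pow_nonneg h.ae_orthant hs.le hu0 _
  have hterm : ∀ m, -(r ^ ((j : ℕ) + 1) * (r * |uR R (u j) m|) * I)
      + (if m = j then r ^ ((j : ℕ) + 1)
          * (uR R (u j) j * (I - ∫ z, sat s (u j) z ^ (p + 1) ∂(ν j)))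
        else 0) ≤ r ^ ((m : ℕ) + 1) * (uR R (u j) m *
        (I - ∫ z, sat s (u j) z ^ (p + 1) ∂(ν m))) := by
    intro m
    have hneg : 0 ≤ r ^ ((j : ℕ) + 1) * (r * |uR R (u j) m|) * I := by positivity
    rcases lt_trichotomy m j with hm | rfl | hm
    · rw [(hu j).uR_eq_zero hm, if_neg hm.ne]
      simp
    · rw [if_pos rfl]
      linarith
    · rw [if_neg hm.ne']
      have hc : uR R (u j) m ≤ 0 := uR_nonpos_of_support hR hu0 ((hu j).2.1 m hm)
      have hν : 0 ≤ ∫ z, sat s (u j) z ^ (p + 1) ∂(ν m) :=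
        integral_sat_pow_nonneg (h.ae_face_orthant m) hs.le hu0 _
      have hpow : r ^ ((m : ℕ) + 1) ≤ r ^ ((j : ℕ) + 1) * r := by
        rw [← pow_succ]
        exact pow_le_pow_of_le_one hr0.le h.r_mem.2.le
          (Nat.succ_le_succ (Nat.succ_le_of_lt (show (j : ℕ) < m from hm)))
      have h1 := mul_le_mul_of_nonneg_right hpow (mul_nonneg (abs_nonneg (uR R (u j) m)) hI0)
      have h2 := mul_nonneg (pow_pos hr0 ((m : ℕ) + 1)).le (mul_nonneg (neg_nonneg.mpr hc) hν)
      rw [abs_of_nonpos hc] at h1 ⊢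
      linarith
  have hsum := Finset.sum_le_sum fun m (_ : m ∈ Finset.univ) => hterm m
  rw [← key, Finset.sum_add_distrib, Finset.sum_ite_eq' Finset.univ j, if_pos (Finset.mem_univ j),
    Finset.sum_neg_distrib, ← Finset.sum_mul, ← Finset.mul_sum, ← Finset.mul_sum] at hsum
  have hJ : ∫ z, (1 - sat s (u j) z) * sat s (u j) z ^ p ∂π ≤ ∫ z, sat s (u j) z ^ p ∂π := by
    have cs := continuous_sat s (u j)
    refine integral_mono_ae (integrable_of_continuous h.ae_orthant (by fun_prop) 1 fun z hz => ?_)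
      (integrable_sat_pow h.ae_orthant hs.le hu0 p) (h.ae_orthant.mono fun z hz => ?_)
    · have h0 := sat_nonneg hs.le hu0 hz
      have h1 := sat_le_one s (u j) z
      rw [abs_mul]
      refine mul_le_one₀ ?_ (abs_nonneg _) (abs_sat_pow_le_one hs.le hu0 hz p)
      rw [abs_le]; constructor <;> linarith
    · have h0 := sat_nonneg hs.le hu0 hz
      exact mul_le_of_le_one_left (pow_nonneg h0 p) (sub_le_self _ h0)
  have hJ0 : 0 ≤ ∫ z, (1 - sat s (u j) z) * sat s (u j) z ^ p ∂π :=
    integral_nonneg_of_ae (h.ae_orthant.mono fun z hz => mul_nonneg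
      (sub_nonneg.mpr (sat_le_one s (u j) z)) (pow_nonneg (sat_nonneg hs.le hu0 hz) p))
  have h7 : (1 / 2) * quadForm Γ (u j) * s * ((p + 1) *
      ∫ z, (1 - sat s (u j) z) * sat s (u j) z ^ p ∂π)
      ≤ (1 / 2) * |quadForm Γ (u j)| * s * ((p + 1) * ∫ z, sat s (u j) z ^ p ∂π) := by
    have := le_abs_self (quadForm Γ (u j))
    gcongr
  have h8 := mul_le_mul_of_nonneg_right (mul_le_mul_of_nonneg_left hr hσ.le) hI0
  refine le_of_mul_le_mul_left ?_ hσ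
  have e : r ^ ((j : ℕ) + 1) * ((1 / 2) * |quadForm Γ (u j)| * (s / r ^ ((j : ℕ) + 1)) * (p + 1) *
      (∫ z, sat s (u j) z ^ p ∂π) + uR R (u j) j * ∫ z, sat s (u j) z ^ (p + 1) ∂(ν j))
      = (1 / 2) * |quadForm Γ (u j)| * s * ((p + 1) * ∫ z, sat s (u j) z ^ p ∂π)
        + r ^ ((j : ℕ) + 1) * (uR R (u j) j * ∫ z, sat s (u j) z ^ (p + 1) ∂(ν j)) := by
    field_simp
  rw [e]
  linarith

lemma tendsto_id_nhdsWithin_Ioo :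
    Tendsto (fun r : ℝ => r) (nhdsWithin (0 : ℝ) (Set.Ioo 0 1)) (nhds 0) :=
  tendsto_id.mono_left nhdsWithin_le_nhds

lemma MomentBound.direction (hR : IsMMatrix R) (h : BARFamily Γ R π ν)
    {u : Fin d → Fin d → ℝ} (hu : ∀ k, IsUk R k (u k)) {j : Fin d} (hM : MomentBound π j)
    (p : ℕ) : ∃ C : ℝ, 0 ≤ C ∧ ∀ᶠ r in nhdsWithin (0 : ℝ) (Set.Ioo 0 1), ∀ s : ℝ, 0 < s →
      ∫ z, sat s (u j) z ^ p ∂(π r) ≤ C * (s / r ^ ((j : ℕ) + 1)) ^ p := by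
  have hu0 := IsUk.nonneg hR hu j
  induction p with
  | zero =>
    refine ⟨1, zero_le_one, h.eventually.mono fun r hr s hs => ?_⟩
    have := hr.prob
    simp
  | succ p ih =>
    obtain ⟨C1, hC1, h1⟩ := ih
    obtain ⟨C2, hC2, h2⟩ := hM.face_scaled hR h hu (p + 1)
    have hρ := IsUk.uR_pos hR.2 hu j
    have hq := abs_nonneg (quadForm Γ (u j))
    set ρ := uR R (u j) j with hρdef
    have hsmall : ∀ᶠ r in nhdsWithin (0 : ℝ) (Set.Ioo 0 1), r * ∑ m, |uR R (u j) m| ≤ ρ / 2 := by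
      have := tendsto_id_nhdsWithin_Ioo.mul_const (∑ m, |uR R (u j) m|)
      rw [zero_mul] at this
      exact this.eventually (eventually_le_nhds (by positivity))
    set B := |quadForm Γ (u j)| * (p + 1) * C1 / ρ + 2 * C2 with hB
    have hB0 : 0 ≤ B := by positivity
    refine ⟨1 + B, by positivity, ?_⟩
    filter_upwards [h.eventually, h1, h2, hsmall] with r hr hr1 hr2 hr3 s hs
    have := hr.prob
    have hr0 : 0 < r := hr.r_mem.1
    have hσ : 0 < r ^ ((j : ℕ) + 1) := by positivity
    have key := hr.sat_recursion hR hu j hr3 hs p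
    have hr1' := hr1 s hs
    set t := s / r ^ ((j : ℕ) + 1) with ht
    have ht0 : 0 < t := by positivity
    rcases le_total s (r ^ ((j : ℕ) + 1)) with hsr | hsr
    · have h9 := hr2 s hs hsr
      rw [← hρdef] at key
      have h10 : (ρ / 2) * ∫ z, sat s (u j) z ^ (p + 1) ∂(π r)
          ≤ (1 / 2) * |quadForm Γ (u j)| * t * (p + 1) * (C1 * t ^ p) + ρ * (C2 * t ^ (p + 1)) := by
        refine key.trans ?_
        gcongr
      have h11 : ∫ z, sat s (u j) z ^ (p + 1) ∂(π r) ≤ B * t ^ (p + 1) := by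
        refine le_of_mul_le_mul_left (h10.trans (le_of_eq ?_)) (half_pos hρ)
        rw [hB]
        field_simp
        ring
      have : 0 ≤ t ^ (p + 1) := by positivity
      linarith
    · have ht1 : 1 ≤ t := (one_le_div hσ).mpr hsr
      have h12 := integral_sat_pow_le_one hr.ae_orthant hs.le hu0 (p + 1)
      have h13 : 1 ≤ t ^ (p + 1) := one_le_pow₀ ht1
      nlinarith

lemma sat_le_add {s s₁ : ℝ} (hs : 0 ≤ s) (hs₁ : 0 ≤ s₁) {w u v z : Fin d → ℝ} (hu : 0 ≤ u)
    (hv : 0 ≤ v) (hz : z ∈ posOrthant d)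
    (hle : s * (w ⬝ᵥ z) ≤ s₁ * (u ⬝ᵥ z) + s * (v ⬝ᵥ z)) :
    sat s w z ≤ sat s₁ u z + sat s v z := by
  have h1 := sat_nonneg hs₁ hu hz
  have h2 := sat_nonneg hs hv hz
  have h3 : Real.exp (-(s₁ * (u ⬝ᵥ z))) * Real.exp (-(s * (v ⬝ᵥ z)))
      ≤ Real.exp (-(s * (w ⬝ᵥ z))) := by
    rw [← Real.exp_add]
    exact Real.exp_le_exp.mpr (by linarith)
  unfold sat at *
  nlinarith

lemma MomentBound.succ (hR : IsMMatrix R) (h : BARFamily Γ R π ν)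
    {u : Fin d → Fin d → ℝ} (hu : ∀ k, IsUk R k (u k)) {j : Fin d} (hM : MomentBound π j) :
    MomentBound π (j + 1) := by
  intro w hw hw0 p
  have hu0 := IsUk.nonneg hR hu j
  have hwj : 0 ≤ w j := hw j
  have hv0 : 0 ≤ Function.update w j 0 := by
    intro i
    rcases eq_or_ne i j with rfl | hi
    · simp
    · simpa [hi] using hw i
  obtain ⟨C1, hC1, h1⟩ := hM.direction hR h hu p
  obtain ⟨C2, hC2, h2⟩ := hM _ hv0 (fun i hi => by
    rcases eq_or_ne i j with rfl | hij
    · simp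
    · rw [Function.update_of_ne hij]
      have : (i : ℕ) ≠ j := fun e => hij (Fin.ext e)
      exact hw0 i (by omega)) p
  refine ⟨2 ^ (p - 1) * (C1 * (w j + 1) ^ p + C2), by positivity, ?_⟩
  filter_upwards [h.eventually, h1, h2] with r hr hr1 hr2 s hs
  have := hr.prob
  have hr0 : 0 < r := hr.r_mem.1
  have hs1 : 0 < s * (w j + 1) := by positivity
  have hi1 := integrable_sat_pow hr.ae_orthant hs1.le hu0 p
  have hi2 := integrable_sat_pow hr.ae_orthant hs.le hv0 p
  have hpt : ∫ z, sat s w z ^ p ∂(π r) ≤ ∫ z, 2 ^ (p - 1) * (sat (s * (w j + 1)) (u j) z ^ p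
      + sat s (Function.update w j 0) z ^ p) ∂(π r) := by
    refine integral_mono_ae (integrable_sat_pow hr.ae_orthant hs.le hw p)
      ((hi1.add hi2).const_mul _) (hr.ae_orthant.mono fun z hz => ?_)
    refine (pow_le_pow_left₀ (sat_nonneg hs.le hw hz) ?_ p).trans
      (add_pow_le (sat_nonneg hs1.le hu0 hz) (sat_nonneg hs.le hv0 hz) p)
    refine sat_le_add hs.le hs1.le hu0 hv0 hz ?_
    have e1 : w ⬝ᵥ z = w j * z j + Function.update w j 0 ⬝ᵥ z := by
      have : w = w j • Pi.single j 1 + Function.update w j 0 := by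
        funext i
        rcases eq_or_ne i j with rfl | hi <;> simp [*]
      conv_lhs => rw [this]
      simp [add_dotProduct, smul_dotProduct]
    have e2 : z j ≤ u j ⬝ᵥ z := by
      have := Finset.single_le_sum (f := fun i => u j i * z i)
        (fun i _ => mul_nonneg (hu0 i) (hz i)) (Finset.mem_univ j)
      simpa [(hu j).1, dotProduct] using this
    have hzj : 0 ≤ z j := hz j
    rw [e1, mul_add, mul_assoc]
    refine add_le_add (mul_le_mul_of_nonneg_left ?_ hs.le) le_rfl
    nlinarith
  rw [integral_const_mul, integral_add hi1 hi2] at hpt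
  refine hpt.trans ?_
  have h3 := hr1 _ hs1
  have h4 := hr2 s hs
  have h5 : s / r ^ (j : ℕ) ≤ s / r ^ ((j : ℕ) + 1) := by
    gcongr 1
    exact pow_le_pow_of_le_one hr0.le hr.r_mem.2.le (Nat.le_succ _)
  have h6 : (s / r ^ (j : ℕ)) ^ p ≤ (s / r ^ ((j : ℕ) + 1)) ^ p := by gcongr
  rw [mul_div_right_comm, mul_pow] at h3
  rw [mul_assoc]
  refine mul_le_mul_of_nonneg_left ?_ (by positivity)
  have := mul_le_mul_of_nonneg_left h6 hC2
  linarith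

lemma momentBound (hR : IsMMatrix R) (h : BARFamily Γ R π ν)
    {u : Fin d → Fin d → ℝ} (hu : ∀ k, IsUk R k (u k)) {k : ℕ} (hk : k ≤ d) :
    MomentBound π k := by
  induction k with
  | zero => exact MomentBound.zero h
  | succ k ih => exact MomentBound.succ (j := ⟨k, hk⟩) hR h hu (ih (Nat.le_of_succ_le hk))

end MomentBounds

section Asymptotics

variable {d : ℕ} {Γ R : Matrix (Fin d) (Fin d) ℝ}
  {π : ℝ → Measure (Fin d → ℝ)} {ν : Fin d → ℝ → Measure (Fin d → ℝ)}

section LaplaceBounds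

lemma laplace_nonneg {μ : Measure (Fin d → ℝ)} (θ : Fin d → ℝ) : 0 ≤ laplace μ θ :=
  integral_nonneg fun _ => (Real.exp_pos _).le

variable {μ : Measure (Fin d → ℝ)} [IsProbabilityMeasure μ]

lemma integrable_laplace (hμ : ∀ᵐ z ∂μ, z ∈ posOrthant d) {θ : Fin d → ℝ} (hθ : 0 ≤ θ) :
    Integrable (fun z => Real.exp (-(θ ⬝ᵥ z))) μ := by
  have := continuous_dotProduct_const θ
  refine integrable_of_continuous hμ (by fun_prop) 1 fun z hz => ?_
  rw [abs_of_pos (Real.exp_pos _)]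
  exact Real.exp_le_one_iff.mpr (neg_nonpos.mpr (dotProduct_nonneg_of_mem hθ hz))

lemma laplace_le_one (hμ : ∀ᵐ z ∂μ, z ∈ posOrthant d) {θ : Fin d → ℝ} (hθ : 0 ≤ θ) :
    laplace μ θ ≤ 1 := by
  calc laplace μ θ ≤ ∫ _, (1 : ℝ) ∂μ :=
        integral_mono_ae (integrable_laplace hμ hθ) (integrable_const _) (hμ.mono fun z hz =>
          Real.exp_le_one_iff.mpr (neg_nonpos.mpr (dotProduct_nonneg_of_mem hθ hz)))
    _ = 1 := by simp

lemma laplace_add_le (hμ : ∀ᵐ z ∂μ, z ∈ posOrthant d) {θ u : Fin d → ℝ} (hθ : 0 ≤ θ) (hu : 0 ≤ u)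
    {s : ℝ} (hs : 0 ≤ s) : laplace μ (s • u + θ) ≤ laplace μ θ := by
  have hsu : 0 ≤ s • u := smul_nonneg hs hu
  refine integral_mono_ae (integrable_laplace hμ (add_nonneg hsu hθ)) (integrable_laplace hμ hθ)
    (hμ.mono fun z hz => Real.exp_le_exp.mpr ?_)
  have := dotProduct_nonneg_of_mem hsu hz
  rw [add_dotProduct]
  linarith

lemma laplace_sub_laplace_add_le (hμ : ∀ᵐ z ∂μ, z ∈ posOrthant d) {θ u : Fin d → ℝ} (hθ : 0 ≤ θ)
    (hu : 0 ≤ u) {s : ℝ} (hs : 0 ≤ s) :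
    laplace μ θ - laplace μ (s • u + θ) ≤ ∫ z, sat s u z ^ 1 ∂μ := by
  have hsu : 0 ≤ s • u := smul_nonneg hs hu
  unfold laplace
  rw [← integral_sub (integrable_laplace hμ hθ) (integrable_laplace hμ (add_nonneg hsu hθ))]
  refine integral_mono_ae ((integrable_laplace hμ hθ).sub
    (integrable_laplace hμ (add_nonneg hsu hθ))) (integrable_sat_pow hμ hs hu 1)
    (hμ.mono fun z hz => ?_)
  have h1 := sat_nonneg hs hu hz
  have h2 : Real.exp (-(θ ⬝ᵥ z)) ≤ 1 :=
    Real.exp_le_one_iff.mpr (neg_nonpos.mpr (dotProduct_nonneg_of_mem hθ hz))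
  have e : Real.exp (-((s • u + θ) ⬝ᵥ z))
      = Real.exp (-(s * (u ⬝ᵥ z))) * Real.exp (-(θ ⬝ᵥ z)) := by
    rw [← Real.exp_add, add_dotProduct, smul_dotProduct, smul_eq_mul, neg_add]
  simp only [pow_one]
  rw [e]
  unfold sat at *
  nlinarith

lemma abs_laplace_add_sub_le (hμ : ∀ᵐ z ∂μ, z ∈ posOrthant d) {θ u : Fin d → ℝ} (hθ : 0 ≤ θ)
    (hu : 0 ≤ u) {s : ℝ} (hs : 0 ≤ s) :
    |laplace μ (s • u + θ) - laplace μ θ| ≤ ∫ z, sat s u z ^ 1 ∂μ := by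
  rw [abs_sub_comm, abs_of_nonneg (sub_nonneg.mpr (laplace_add_le hμ hθ hu hs))]
  exact laplace_sub_laplace_add_le hμ hθ hu hs

end LaplaceBounds

/-- The vector `∑_{ℓ > k} r^(ℓ - k) η_ℓ u_ℓ`. -/
def tail (u : Fin d → Fin d → ℝ) (η : Fin d → ℝ) (k : Fin d) (r : ℝ) : Fin d → ℝ :=
  ∑ ℓ : Fin d, (if k < ℓ then r ^ ((ℓ : ℕ) - k) * η ℓ else 0) • u ℓ

/-- The rescaled argument `a u_k + ∑_{ℓ > k} r^(ℓ - k) η_ℓ u_ℓ`. -/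
def dir (u : Fin d → Fin d → ℝ) (η : Fin d → ℝ) (k : Fin d) (a r : ℝ) : Fin d → ℝ :=
  a • u k + tail u η k r

/-- The argument `r^k a u_k + ∑_{ℓ > k} r^ℓ η_ℓ u_ℓ` of the Laplace transforms (with indices
starting from one). -/
def arg (u : Fin d → Fin d → ℝ) (η : Fin d → ℝ) (k : Fin d) (a r : ℝ) : Fin d → ℝ :=
  r ^ ((k : ℕ) + 1) • dir u η k a r

variable {u : Fin d → Fin d → ℝ} {η : Fin d → ℝ}

lemma tail_nonneg (hu : ∀ k, 0 ≤ u k) (hη : 0 ≤ η) (k : Fin d) {r : ℝ} (hr : 0 ≤ r) :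
    0 ≤ tail u η k r := by
  refine Finset.sum_nonneg fun ℓ _ => smul_nonneg ?_ (hu ℓ)
  split_ifs
  · exact mul_nonneg (pow_nonneg hr _) (hη ℓ)
  · exact le_rfl

lemma dir_nonneg (hu : ∀ k, 0 ≤ u k) (hη : 0 ≤ η) (k : Fin d) {a r : ℝ} (ha : 0 ≤ a)
    (hr : 0 ≤ r) : 0 ≤ dir u η k a r :=
  add_nonneg (smul_nonneg ha (hu k)) (tail_nonneg hu hη k hr)

lemma arg_nonneg (hu : ∀ k, 0 ≤ u k) (hη : 0 ≤ η) (k : Fin d) {a r : ℝ} (ha : 0 ≤ a)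
    (hr : 0 ≤ r) : 0 ≤ arg u η k a r :=
  smul_nonneg (pow_nonneg hr _) (dir_nonneg hu hη k ha hr)

lemma arg_eq (k : Fin d) (a r : ℝ) :
    arg u η k a r = (a * r ^ ((k : ℕ) + 1)) • u k + arg u η k 0 r := by
  simp only [arg, dir, smul_add, zero_smul, zero_add, smul_smul, mul_comm a]

lemma uR_dir (hu : ∀ k, IsUk R k (u k)) {m k : Fin d} (hm : m ≤ k) (a r : ℝ) :
    uR R (dir u η k a r) m = if m = k then a * uR R (u k) k else 0 := by
  have h0 : uR R (tail u η k r) m = 0 := by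
    rw [tail, uR_sum]
    refine Finset.sum_eq_zero fun ℓ _ => ?_
    rw [uR_smul]
    split_ifs with hℓ
    · rw [(hu ℓ).uR_eq_zero (hm.trans_lt hℓ), mul_zero]
    · rw [zero_mul]
  rw [dir, uR_add, uR_smul, h0, add_zero]
  rcases eq_or_lt_of_le hm with rfl | hlt
  · simp
  · rw [(hu k).uR_eq_zero hlt, if_neg hlt.ne, mul_zero]

lemma continuous_dir (k : Fin d) (a : ℝ) : Continuous (dir u η k a) := by
  unfold dir tail
  refine continuous_const.add (continuous_finsetSum _ fun ℓ _ => ?_)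
  split_ifs <;> fun_prop

lemma dir_zero (k : Fin d) (a : ℝ) : dir u η k a 0 = a • u k := by
  have : tail u η k 0 = 0 := by
    refine Finset.sum_eq_zero fun ℓ _ => ?_
    split_ifs with h
    · have : (ℓ : ℕ) - k ≠ 0 := by have : (k : ℕ) < ℓ := h; omega
      simp [this]
    · simp
  rw [dir, this, add_zero]

lemma tendsto_mul_zero_of_abs_le {ι : Type*} {l : Filter ι} {f g : ι → ℝ} {C : ℝ}
    (hf : Tendsto f l (nhds 0)) (hg : ∀ᶠ x in l, |g x| ≤ C) :
    Tendsto (fun x => f x * g x) l (nhds 0) := by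
  refine squeeze_zero_norm' (a := fun x => |f x| * C) (hg.mono fun x hx => ?_) ?_
  · rw [norm_mul]
    exact mul_le_mul_of_nonneg_left hx (abs_nonneg _)
  · simpa using hf.abs.mul_const C

lemma tendsto_pole (hR : IsMMatrix R) (h : BARFamily Γ R π ν) (hu : ∀ k, IsUk R k (u k))
    (hη : 0 ≤ η) (k : Fin d) {a : ℝ} (ha : 0 ≤ a) :
    Tendsto (fun r => (1 / 2) * (a ^ 2 * quadForm Γ (u k)) * laplace (π r) (arg u η k a r)
      + a * uR R (u k) k * (laplace (π r) (arg u η k a r) - laplace (ν k r) (arg u η k a r)))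
      (nhdsWithin 0 (Set.Ioo 0 1)) (nhds 0) := by
  have hu0 := IsUk.nonneg hR hu
  have hφ : ∀ᶠ r in nhdsWithin (0 : ℝ) (Set.Ioo 0 1), |laplace (π r) (arg u η k a r)| ≤ 1 :=
    h.eventually.mono fun r hr => by
      have := hr.prob
      rw [abs_of_nonneg (laplace_nonneg _)]
      exact laplace_le_one hr.ae_orthant (arg_nonneg hu0 hη k ha hr.r_mem.1.le)
  have hφν : ∀ m, ∀ᶠ r in nhdsWithin (0 : ℝ) (Set.Ioo 0 1),
      |laplace (π r) (arg u η k a r) - laplace (ν m r) (arg u η k a r)| ≤ 1 := fun m =>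
    h.eventually.mono fun r hr => by
      have := hr.prob
      have := hr.prob_face
      have hθ := arg_nonneg hu0 hη k ha hr.r_mem.1.le
      have h1 := laplace_le_one hr.ae_orthant hθ
      have h2 := laplace_le_one (hr.ae_face_orthant m) hθ
      have h3 := laplace_nonneg (μ := π r) (arg u η k a r)
      have h4 := laplace_nonneg (μ := ν m r) (arg u η k a r)
      rw [abs_le]
      constructor <;> linarith
  have hq : Tendsto (fun r => (1 / 2) * (a ^ 2 * quadForm Γ (u k)
      - quadForm Γ (dir u η k a r))) (nhdsWithin 0 (Set.Ioo 0 1)) (nhds 0) := by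
    have c : Continuous fun r => (1 / 2) * (a ^ 2 * quadForm Γ (u k)
        - quadForm Γ (dir u η k a r)) := by
      have := continuous_dir (u := u) (η := η) k a
      unfold quadForm
      fun_prop
    have := (c.tendsto 0).mono_left (nhdsWithin_le_nhds (s := Set.Ioo 0 1))
    rwa [dir_zero, quadForm_smul, sub_self, mul_zero] at this
  have hm : ∀ m : Fin d, Tendsto (fun r => if k < m then
      -(r ^ ((m : ℕ) - k) * uR R (dir u η k a r) m) else 0)
      (nhdsWithin 0 (Set.Ioo 0 1)) (nhds 0) := by
    intro m
    split_ifs with hkm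
    · have c : Continuous fun r => -(r ^ ((m : ℕ) - k) * uR R (dir u η k a r) m) := by
        have := continuous_dir (u := u) (η := η) k a
        unfold uR
        fun_prop
      have := (c.tendsto 0).mono_left (nhdsWithin_le_nhds (s := Set.Ioo 0 1))
      have hne : (m : ℕ) - k ≠ 0 := by have : (k : ℕ) < m := hkm; omega
      simpa [hne] using this
    · exact tendsto_const_nhds
  have key := (tendsto_mul_zero_of_abs_le hq hφ).add
    (tendsto_finsetSum Finset.univ fun m _ => tendsto_mul_zero_of_abs_le (hm m) (hφν m))
  rw [Finset.sum_const_zero, add_zero] at key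
  refine key.congr' (h.eventually.mono fun r hr => ?_)
  have hr0 : 0 < r := hr.r_mem.1
  have hb := hr.laplace_bar (arg_nonneg hu0 hη k ha hr0.le)
  have hterm : ∀ m : Fin d, r ^ ((m : ℕ) + 1) * (uR R (arg u η k a r) m *
      (laplace (π r) (arg u η k a r) - laplace (ν m r) (arg u η k a r)))
      = (r ^ ((k : ℕ) + 1)) ^ 2 * ((if m = k then a * uR R (u k) k * (laplace (π r) (arg u η k a r)
          - laplace (ν k r) (arg u η k a r)) else 0)
        - (if k < m then -(r ^ ((m : ℕ) - k) * uR R (dir u η k a r) m) else 0) *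
          (laplace (π r) (arg u η k a r) - laplace (ν m r) (arg u η k a r))) := by
    intro m
    rw [show uR R (arg u η k a r) m = r ^ ((k : ℕ) + 1) * uR R (dir u η k a r) m from uR_smul ..]
    rcases lt_trichotomy m k with hmk | rfl | hkm
    · rw [uR_dir hu hmk.le, if_neg hmk.ne, if_neg hmk.not_gt, if_neg hmk.ne]
      ring
    · rw [uR_dir hu le_rfl, if_pos rfl, if_pos rfl, if_neg (lt_irrefl _)]
      ring
    · rw [if_neg hkm.ne', if_pos hkm]
      have : r ^ ((m : ℕ) + 1) = r ^ ((k : ℕ) + 1) * r ^ ((m : ℕ) - k) := by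
        rw [← pow_add]
        congr 1
        have : (k : ℕ) < m := hkm
        omega
      rw [this]
      ring
  rw [Finset.sum_congr rfl fun m _ => hterm m, ← Finset.mul_sum, Finset.sum_sub_distrib,
    Finset.sum_ite_eq' Finset.univ k, if_pos (Finset.mem_univ k),
    show quadForm Γ (arg u η k a r) = (r ^ ((k : ℕ) + 1)) ^ 2 * quadForm Γ (dir u η k a r) from
      quadForm_smul ..] at hb
  have hσ : (r ^ ((k : ℕ) + 1)) ^ 2 ≠ 0 := by positivity
  apply mul_left_cancel₀ hσ
  linear_combination -hb

lemma tendsto_face_sat (hR : IsMMatrix R) (h : BARFamily Γ R π ν) (hu : ∀ k, IsUk R k (u k))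
    (k : Fin d) {a : ℝ} (ha : 0 < a) :
    Tendsto (fun r => ∫ z, sat (a * r ^ ((k : ℕ) + 1)) (u k) z ^ 1 ∂(ν k r))
      (nhdsWithin 0 (Set.Ioo 0 1)) (nhds 0) := by
  have hu0 := IsUk.nonneg hR hu k
  obtain ⟨C, hC, hf⟩ := (momentBound hR h hu k.2.le).face hR h hu k
  have hsmall : ∀ᶠ r in nhdsWithin (0 : ℝ) (Set.Ioo 0 1), a * r ^ ((k : ℕ) + 1) ≤ 1 := by
    have := (tendsto_id_nhdsWithin_Ioo.pow ((k : ℕ) + 1)).const_mul a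
    simp only [ne_eq, Nat.add_eq_zero_iff, one_ne_zero, and_false, not_false_eq_true, zero_pow,
      mul_zero] at this
    exact this.eventually (eventually_le_nhds one_pos)
  have hN : Tendsto (fun r => ∫ z, sat (a * r ^ ((k : ℕ) + 1)) (u k) z ^ ((k : ℕ) + 2) ∂(ν k r))
      (nhdsWithin 0 (Set.Ioo 0 1)) (nhds 0) := by
    refine squeeze_zero' (g := fun r => C * a ^ ((k : ℕ) + 2) * r)
      (h.eventually.mono fun r hr => ?_) ?_ ?_
    · have hr0 := hr.r_mem.1
      exact integral_sat_pow_nonneg (hr.ae_face_orthant k) (by positivity) hu0 _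
    · filter_upwards [h.eventually, hf, hsmall] with r hr hr1 hr2
      have hr0 := hr.r_mem.1
      have := hr1 _ (by positivity) hr2
      have hσ : 0 < r ^ ((k : ℕ) + 1) := by positivity
      refine le_of_mul_le_mul_left (this.trans (le_of_eq ?_)) hσ
      rw [show a * r ^ ((k : ℕ) + 1) / r ^ (k : ℕ) = a * r by rw [pow_succ]; field_simp]
      ring
    · simpa using tendsto_id_nhdsWithin_Ioo.const_mul (C * a ^ ((k : ℕ) + 2))
  refine tendsto_order.mpr ⟨fun b hb => h.eventually.mono fun r hr => ?_, fun ε hε => ?_⟩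
  · have hr0 := hr.r_mem.1
    exact hb.trans_le (integral_sat_pow_nonneg (hr.ae_face_orthant k) (by positivity) hu0 _)
  · have ht : 0 < (ε / 2) * (ε / 2) ^ ((k : ℕ) + 1) := by positivity
    filter_upwards [h.eventually, hN.eventually (eventually_lt_nhds ht)] with r hr hr1
    have hr0 := hr.r_mem.1
    have := hr.prob_face k
    have h1 := integral_sat_pow_mul_le (hr.ae_face_orthant k)
      (s := a * r ^ ((k : ℕ) + 1)) (by positivity) hu0 (half_pos hε).le 1 ((k : ℕ) + 1)
    rw [show 1 + ((k : ℕ) + 1) = (k : ℕ) + 2 by ring] at h1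
    refine lt_of_mul_lt_mul_right (h1.trans_lt ?_) (pow_nonneg (half_pos hε).le ((k : ℕ) + 1))
    calc _ < (ε / 2) ^ ((k : ℕ) + 2) + (ε / 2) * (ε / 2) ^ ((k : ℕ) + 1) := by linarith
      _ = _ := by ring

lemma tendsto_face_laplace_sub (hR : IsMMatrix R) (h : BARFamily Γ R π ν)
    (hu : ∀ k, IsUk R k (u k)) (hη : 0 ≤ η) (k : Fin d) {a : ℝ} (ha : 0 < a) :
    Tendsto (fun r => laplace (ν k r) (arg u η k a r) - laplace (ν k r) (arg u η k 0 r))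
      (nhdsWithin 0 (Set.Ioo 0 1)) (nhds 0) := by
  have hu0 := IsUk.nonneg hR hu
  refine squeeze_zero_norm' (h.eventually.mono fun r hr => ?_) (tendsto_face_sat hR h hu k ha)
  have hr0 := hr.r_mem.1
  have := hr.prob_face k
  rw [arg_eq]
  exact abs_laplace_add_sub_le (hr.ae_face_orthant k) (arg_nonneg hu0 hη k le_rfl hr0.le) (hu0 k)
    (by positivity)

lemma tendsto_face_sub_interior (hΓ : Γ.PosDef) (hR : IsMMatrix R) (h : BARFamily Γ R π ν)
    (hu : ∀ k, IsUk R k (u k)) (hη : 0 ≤ η) (k : Fin d) :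
    Tendsto (fun r => laplace (ν k r) (arg u η k 0 r) - laplace (π r) (arg u η k 0 r))
      (nhdsWithin 0 (Set.Ioo 0 1)) (nhds 0) := by
  have hu0 := IsUk.nonneg hR hu
  obtain ⟨C, hC, hCr⟩ := (momentBound hR h hu k.2.le).direction hR h hu 1
  have hρ := IsUk.uR_pos hR.2 hu k
  have hq := quadForm_pos hΓ (hu k).ne_zero
  set ρ := uR R (u k) k
  set q := quadForm Γ (u k)
  set M := q / (2 * ρ) + C + 1 with hM
  have hM0 : 0 < M := by positivity
  rw [tendsto_zero_iff_abs_tendsto_zero]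
  refine tendsto_order.mpr ⟨fun b hb => Eventually.of_forall fun r => hb.trans_le (abs_nonneg _),
    fun ε hε => ?_⟩
  set δ := ε / (2 * M) with hδ
  have hδ0 : 0 < δ := by positivity
  have e1 : ∀ᶠ r in nhdsWithin (0 : ℝ) (Set.Ioo 0 1), _ :=
    (tendsto_pole hR h hu hη k hδ0.le).abs.eventually
      (eventually_lt_nhds (b := ε / 4 * (δ * ρ)) (by rw [abs_zero]; positivity))
  have e2 : ∀ᶠ r in nhdsWithin (0 : ℝ) (Set.Ioo 0 1), _ :=
    (tendsto_face_laplace_sub hR h hu hη k hδ0).abs.eventually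
      (eventually_lt_nhds (b := ε / 4) (by rw [abs_zero]; positivity))
  filter_upwards [h.eventually, e1, e2, hCr] with r hr h1 h2 h3
  have hr0 := hr.r_mem.1
  have := hr.prob
  have h4 : |laplace (π r) (arg u η k δ r) - laplace (π r) (arg u η k 0 r)| ≤ C * δ := by
    rw [arg_eq k δ]
    refine (abs_laplace_add_sub_le hr.ae_orthant (arg_nonneg hu0 hη k le_rfl hr0.le) (hu0 k)
      (by positivity)).trans ((h3 _ (by positivity)).trans (le_of_eq ?_))
    field_simp
  have h5 := laplace_le_one hr.ae_orthant (arg_nonneg hu0 hη k hδ0.le hr0.le)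
  have h6 := laplace_nonneg (μ := π r) (arg u η k δ r)
  set φ := laplace (π r) (arg u η k δ r)
  set ψ := laplace (ν k r) (arg u η k δ r)
  set φ0 := laplace (π r) (arg u η k 0 r)
  set ψ0 := laplace (ν k r) (arg u η k 0 r)
  have h7 : |φ - ψ| ≤ ε / 4 + δ * (q / (2 * ρ)) := by
    have hδρ : 0 < δ * ρ := by positivity
    refine le_of_mul_le_mul_left ?_ hδρ
    rw [← abs_of_pos hδρ, ← abs_mul, abs_of_pos hδρ]
    have e : δ * ρ * (ε / 4 + δ * (q / (2 * ρ))) = ε / 4 * (δ * ρ) + (1 / 2) * (δ ^ 2 * q) * 1 := by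
      field_simp
    have e' : δ * ρ * (φ - ψ) = (1 / 2 * (δ ^ 2 * q) * φ + δ * ρ * (φ - ψ))
        - 1 / 2 * (δ ^ 2 * q) * φ := by ring
    rw [e, e']
    refine (abs_sub _ _).trans (add_le_add h1.le ?_)
    rw [abs_of_nonneg (by positivity)]
    gcongr
  have h8 : δ * M = ε / 2 := by
    rw [hδ]; field_simp
  have h9 : ψ0 - φ0 = -(ψ - ψ0) + -(φ - ψ) + (φ - φ0) := by ring
  change |ψ0 - φ0| < ε
  rw [h9]
  calc |-(ψ - ψ0) + -(φ - ψ) + (φ - φ0)|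
      ≤ |-(ψ - ψ0)| + |-(φ - ψ)| + |φ - φ0| := abs_add_three _ _ _
    _ = |ψ - ψ0| + |φ - ψ| + |φ - φ0| := by rw [abs_neg, abs_neg]
    _ < ε := by
      rw [hM, mul_add, mul_add] at h8
      linarith

lemma tendsto_laplace_step (hΓ : Γ.PosDef) (hR : IsMMatrix R) (h : BARFamily Γ R π ν)
    (hu : ∀ k, IsUk R k (u k)) (hη : 0 ≤ η) (k : Fin d) {a c : ℝ} (ha : 0 ≤ a)
    (hc : Tendsto (fun r => laplace (π r) (arg u η k 0 r)) (nhdsWithin 0 (Set.Ioo 0 1)) (nhds c)) :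
    Tendsto (fun r => laplace (π r) (arg u η k a r)) (nhdsWithin 0 (Set.Ioo 0 1))
      (nhds ((1 + a * meanOf Γ R (u k) k)⁻¹ * c)) := by
  rcases eq_or_lt_of_le ha with rfl | ha
  · simpa using hc
  have hρ := IsUk.uR_pos hR.2 hu k
  have hq := quadForm_pos hΓ (hu k).ne_zero
  have h1 := ((tendsto_face_laplace_sub hR h hu hη k ha).add
    (tendsto_face_sub_interior hΓ hR h hu hη k)).add hc
  have h2 := (((tendsto_pole hR h hu hη k ha.le).add
    (h1.const_mul (a * uR R (u k) k))).const_mul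
      ((1 / 2) * (a ^ 2 * quadForm Γ (u k)) + a * uR R (u k) k)⁻¹)
  have e : ((1 / 2) * (a ^ 2 * quadForm Γ (u k)) + a * uR R (u k) k)⁻¹ *
      (0 + a * uR R (u k) k * (0 + 0 + c)) = (1 + a * meanOf Γ R (u k) k)⁻¹ * c := by
    unfold meanOf
    set ρ := uR R (u k) k
    set q := quadForm Γ (u k)
    have : 0 < 1 + a * (q / (2 * ρ)) := by positivity
    have : 0 < (1 / 2) * (a ^ 2 * q) + a * ρ := by positivity
    field_simp
    ring
  rw [e] at h2
  refine h2.congr fun r => ?_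
  have : 0 < (1 / 2) * (a ^ 2 * quadForm Γ (u k)) + a * uR R (u k) k := by positivity
  rw [inv_mul_eq_iff_eq_mul₀ this.ne']
  ring

end Asymptotics

section LaplaceLimit

variable {d : ℕ} {Γ R : Matrix (Fin d) (Fin d) ℝ}
  {π : ℝ → Measure (Fin d → ℝ)} {ν : Fin d → ℝ → Measure (Fin d → ℝ)}
  {u : Fin d → Fin d → ℝ} {η : Fin d → ℝ}

/-- The vector `∑_{ℓ ≥ n} r^(ℓ + 1) η_ℓ u_ℓ`. -/
def partialArg (u : Fin d → Fin d → ℝ) (η : Fin d → ℝ) (n : ℕ) (r : ℝ) : Fin d → ℝ :=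
  ∑ ℓ : Fin d, (if n ≤ ℓ then r ^ ((ℓ : ℕ) + 1) * η ℓ else 0) • u ℓ

lemma partialArg_succ (k : Fin d) (r : ℝ) : partialArg u η (k + 1) r = arg u η k 0 r := by
  rw [arg, dir, zero_smul, zero_add, tail, Finset.smul_sum, partialArg]
  refine Finset.sum_congr rfl fun ℓ _ => ?_
  rw [smul_smul]
  by_cases h : k < ℓ
  · have h' : (k : ℕ) < ℓ := h
    rw [if_pos h, if_pos (Nat.succ_le_of_lt h'), ← mul_assoc, ← pow_add]
    congr 3
    omega
  · have h' : ¬ (k : ℕ) + 1 ≤ ℓ := fun h' => h (Nat.lt_of_succ_le h')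
    rw [if_neg h, if_neg h', mul_zero]

lemma partialArg_coe (k : Fin d) (r : ℝ) : partialArg u η k r = arg u η k (η k) r := by
  rw [arg_eq, ← partialArg_succ, partialArg, partialArg,
    ← Finset.sum_erase_add _ _ (Finset.mem_univ k), if_pos le_rfl, add_comm]
  congr 1
  · rw [mul_comm]
  · rw [← Finset.sum_erase_add _ _ (Finset.mem_univ k), if_neg (Nat.not_succ_le_self _), zero_smul,
      add_zero]
    refine Finset.sum_congr rfl fun ℓ hℓ => ?_
    have hne : (ℓ : ℕ) ≠ k := fun e => Finset.ne_of_mem_erase hℓ (Fin.ext e)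
    have : (k : ℕ) ≤ ℓ ↔ (k : ℕ) + 1 ≤ ℓ := by omega
    simp only [this]

lemma tendsto_laplace_partialArg (hΓ : Γ.PosDef) (hR : IsMMatrix R) (h : BARFamily Γ R π ν)
    (hu : ∀ k, IsUk R k (u k)) (hη : 0 ≤ η) (m n : ℕ) (hmn : n + m = d) :
    Tendsto (fun r => laplace (π r) (partialArg u η n r)) (nhdsWithin 0 (Set.Ioo 0 1))
      (nhds (∏ ℓ : Fin d, if n ≤ ℓ then (1 + η ℓ * meanOf Γ R (u ℓ) ℓ)⁻¹ else 1)) := by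
  induction m generalizing n with
  | zero =>
    have h0 : ∀ ℓ : Fin d, ¬ n ≤ (ℓ : ℕ) := fun ℓ => by omega
    simp only [partialArg, h0, if_false, zero_smul, Finset.sum_const_zero, Finset.prod_const_one]
    refine tendsto_const_nhds.congr' (h.eventually.mono fun r hr => ?_)
    have := hr.prob
    simp [laplace]
  | succ m ih =>
    obtain ⟨k, rfl⟩ : ∃ k : Fin d, (k : ℕ) = n := ⟨⟨n, by omega⟩, rfl⟩
    have h1 := ih (k + 1) (by omega)
    simp only [partialArg_succ] at h1
    have h2 := tendsto_laplace_step hΓ hR h hu hη k (hη k) h1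
    simp only [partialArg_coe]
    convert h2 using 2
    rw [← Finset.mul_prod_erase _ _ (Finset.mem_univ k), if_pos le_rfl,
      ← Finset.mul_prod_erase _ (fun ℓ : Fin d => if (k : ℕ) + 1 ≤ ℓ then _ else _)
        (Finset.mem_univ k), if_neg (Nat.not_succ_le_self _), one_mul]
    congr 1
    refine Finset.prod_congr rfl fun ℓ hℓ => ?_
    have hne : (ℓ : ℕ) ≠ k := fun e => Finset.ne_of_mem_erase hℓ (Fin.ext e)
    have : (k : ℕ) ≤ ℓ ↔ (k : ℕ) + 1 ≤ ℓ := by omega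
    simp only [this]

lemma abs_laplace_sum_add_sub_le {μ : Measure (Fin d → ℝ)} [IsProbabilityMeasure μ]
    (hμ : ∀ᵐ z ∂μ, z ∈ posOrthant d) {ι : Type*} (t : Finset ι) {a : ι → ℝ} (ha : 0 ≤ a)
    {w : ι → Fin d → ℝ} (hw : ∀ i, 0 ≤ w i) {θ : Fin d → ℝ} (hθ : 0 ≤ θ) :
    |laplace μ (∑ i ∈ t, a i • w i + θ) - laplace μ θ|
      ≤ ∑ i ∈ t, ∫ z, sat (a i) (w i) z ^ 1 ∂μ := by
  classical
  induction t using Finset.induction_on with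
  | empty => simp
  | insert i t hi ih =>
    rw [Finset.sum_insert hi, Finset.sum_insert hi, add_assoc]
    have hs : 0 ≤ ∑ i ∈ t, a i • w i + θ :=
      add_nonneg (Finset.sum_nonneg fun i _ => smul_nonneg (ha i) (hw i)) hθ
    exact (abs_sub_le _ _ _).trans (add_le_add (abs_laplace_add_sub_le hμ hs (hw i) (ha i)) ih)

/-- Convergence of the Laplace transforms of the scaled stationary distributions. -/
lemma tendsto_laplace (hΓ : Γ.PosDef) (hR : IsMMatrix R) (h : BARFamily Γ R π ν)
    (hu : ∀ k, IsUk R k (u k)) (hη : 0 ≤ η) :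
    Tendsto (fun r => laplace (π r) fun i => r ^ ((i : ℕ) + 1) * η i)
      (nhdsWithin 0 (Set.Ioo 0 1)) (nhds (∏ ℓ : Fin d, (1 + η ℓ * meanOf Γ R (u ℓ) ℓ)⁻¹)) := by
  have h0 := tendsto_laplace_partialArg hΓ hR h hu hη d 0 (zero_add d)
  simp only [zero_le, if_true, partialArg] at h0
  have hw : ∀ ℓ, 0 ≤ u ℓ - Pi.single ℓ 1 := IsUk.sub_single_nonneg hR hu
  have hsat : ∀ ℓ : Fin d, Tendsto (fun r => ∫ z, sat (r ^ ((ℓ : ℕ) + 1) * η ℓ)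
      (u ℓ - Pi.single ℓ 1) z ^ 1 ∂(π r)) (nhdsWithin 0 (Set.Ioo 0 1)) (nhds 0) := by
    intro ℓ
    rcases eq_or_lt_of_le (hη ℓ) with he | hpos
    · have he' : η ℓ = 0 := he.symm
      simp [sat, he']
    · have hpos : 0 < η ℓ := hpos
      obtain ⟨C, hC, hCr⟩ := momentBound hR h hu ℓ.2.le _ (hw ℓ) (hu ℓ).sub_single_eq_zero 1
      refine squeeze_zero' (g := fun r => C * η ℓ * r) (h.eventually.mono fun r hr => ?_) ?_ ?_
      · have hr0 := hr.r_mem.1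
        exact integral_sat_pow_nonneg hr.ae_orthant (by positivity) (hw ℓ) 1
      · filter_upwards [h.eventually, hCr] with r hr hr1
        have hr0 := hr.r_mem.1
        refine (hr1 _ (by positivity)).trans (le_of_eq ?_)
        rw [pow_one, pow_succ]
        field_simp
      · simpa using tendsto_id_nhdsWithin_Ioo.const_mul (C * η ℓ)
  have hsum := tendsto_finsetSum Finset.univ fun (ℓ : Fin d) _ => hsat ℓ
  rw [Finset.sum_const_zero] at hsum
  have hdiff : Tendsto (fun r => laplace (π r) (∑ ℓ : Fin d, (r ^ ((ℓ : ℕ) + 1) * η ℓ) • u ℓ)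
      - laplace (π r) fun i : Fin d => r ^ ((i : ℕ) + 1) * η i)
      (nhdsWithin 0 (Set.Ioo 0 1)) (nhds 0) := by
    refine squeeze_zero_norm' (h.eventually.mono fun r hr => ?_) hsum
    have hr0 := hr.r_mem.1
    have := hr.prob
    have ha : (0 : Fin d → ℝ) ≤ fun ℓ : Fin d => r ^ ((ℓ : ℕ) + 1) * η ℓ :=
      fun ℓ => mul_nonneg (pow_nonneg hr0.le _) (hη ℓ)
    have e : ∑ ℓ : Fin d, (r ^ ((ℓ : ℕ) + 1) * η ℓ) • u ℓ
        = ∑ ℓ : Fin d, (r ^ ((ℓ : ℕ) + 1) * η ℓ) • (u ℓ - Pi.single ℓ 1)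
          + fun i : Fin d => r ^ ((i : ℕ) + 1) * η i := by
      simp only [smul_sub, Finset.sum_sub_distrib]
      rw [eq_comm, sub_add_eq_add_sub, sub_eq_iff_eq_add, add_right_inj]
      funext i
      simp [Finset.sum_apply, Pi.single_apply]
    rw [e]
    exact abs_laplace_sum_add_sub_le hr.ae_orthant Finset.univ ha hw ha
  simpa using h0.sub hdiff

end LaplaceLimit

section WeakConvergence

variable {d : ℕ}

/-- The map `x ↦ (e^{-x_i⁺})_i` into the unit cube. -/
def expCube (x : Fin d → ℝ) (i : Fin d) : unitInterval :=
  ⟨Real.exp (-max (x i) 0), (Real.exp_pos _).le, by simp⟩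

lemma continuous_expCube : Continuous (expCube : (Fin d → ℝ) → Fin d → unitInterval) := by
  unfold expCube
  fun_prop

lemma expCube_pos (x : Fin d → ℝ) (i : Fin d) : 0 < (expCube x i : ℝ) := Real.exp_pos _

/-- The `i`-th coordinate function on the unit cube. -/
def cubeCoord (i : Fin d) : C(Fin d → unitInterval, ℝ) :=
  ⟨fun t => t i, by fun_prop⟩

lemma adjoin_cubeCoord_topologicalClosure :
    (Algebra.adjoin ℝ (Set.range (cubeCoord (d := d)))).topologicalClosure = ⊤ := by
  refine ContinuousMap.subalgebra_topologicalClosure_eq_top_of_separatesPoints _ ?_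
  intro x y hxy
  obtain ⟨i, hi⟩ := Function.ne_iff.1 hxy
  exact ⟨_, ⟨cubeCoord i, Algebra.subset_adjoin ⟨i, rfl⟩, rfl⟩, fun h => hi (Subtype.ext h)⟩

lemma exists_eq_prod_pow_of_mem_closure {f : C(Fin d → unitInterval, ℝ)}
    (hf : f ∈ Submonoid.closure (Set.range (cubeCoord (d := d)))) :
    ∃ n : Fin d → ℕ, ∀ t, f t = ∏ i, (t i : ℝ) ^ n i := by
  induction hf using Submonoid.closure_induction with
  | mem f hf =>
    obtain ⟨i, rfl⟩ := hf
    refine ⟨Pi.single i 1, fun t => ?_⟩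
    rw [Finset.prod_eq_single i]
    · simp [cubeCoord]
    · intro j _ hj
      simp [hj]
    · simp
  | one => exact ⟨0, by simp⟩
  | mul f g _ _ hf hg =>
    obtain ⟨n, hn⟩ := hf
    obtain ⟨m, hm⟩ := hg
    exact ⟨n + m, fun t => by simp [hn, hm, pow_add, Finset.prod_mul_distrib]⟩

lemma integrable_comp_expCube (μ : Measure (Fin d → ℝ)) [IsFiniteMeasure μ]
    (F : C(Fin d → unitInterval, ℝ)) : Integrable (fun x => F (expCube x)) μ :=
  (integrable_const ‖F‖).mono' (F.continuous.comp continuous_expCube).aestronglyMeasurable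
    (.of_forall fun _ => F.norm_coe_le_norm _)

lemma prod_expCube_pow_of_mem {x : Fin d → ℝ} (hx : x ∈ posOrthant d) (n : Fin d → ℕ) :
    ∏ i, (expCube x i : ℝ) ^ n i = Real.exp (-((fun i => (n i : ℝ)) ⬝ᵥ x)) := by
  simp only [expCube, ← Real.exp_nat_mul, ← Real.exp_sum, dotProduct, ← Finset.sum_neg_distrib]
  congr 1
  refine Finset.sum_congr rfl fun i _ => ?_
  rw [max_eq_left (hx i)]
  ring

variable {ι : Type*} {l : Filter ι} {μ : ι → Measure (Fin d → ℝ)} {μ₀ : Measure (Fin d → ℝ)}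

lemma tendsto_integral_comp_expCube [IsProbabilityMeasure μ₀] (h₀ : ∀ᵐ x ∂μ₀, x ∈ posOrthant d)
    (hμ : ∀ᶠ r in l, IsProbabilityMeasure (μ r) ∧ ∀ᵐ x ∂(μ r), x ∈ posOrthant d)
    (h : ∀ n : Fin d → ℕ, Tendsto (fun r => laplace (μ r) fun i => (n i : ℝ)) l
      (nhds (laplace μ₀ fun i => (n i : ℝ)))) (F : C(Fin d → unitInterval, ℝ)) :
    Tendsto (fun r => ∫ x, F (expCube x) ∂(μ r)) l (nhds (∫ x, F (expCube x) ∂μ₀)) := by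
  have hspan : ∀ G ∈ Submodule.span ℝ
      (Submonoid.closure (Set.range (cubeCoord (d := d))) : Set C(Fin d → unitInterval, ℝ)),
      Tendsto (fun r => ∫ x, G (expCube x) ∂(μ r)) l (nhds (∫ x, G (expCube x) ∂μ₀)) := by
    intro G hG
    induction hG using Submodule.span_induction with
    | mem G hG =>
      obtain ⟨n, hn⟩ := exists_eq_prod_pow_of_mem_closure hG
      have key : ∀ {ρ : Measure (Fin d → ℝ)}, (∀ᵐ x ∂ρ, x ∈ posOrthant d) →
          laplace ρ (fun i => (n i : ℝ)) = ∫ x, G (expCube x) ∂ρ := fun hρ =>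
        integral_congr_ae (hρ.mono fun x hx => by simp only [hn, prod_expCube_pow_of_mem hx])
      rw [← key h₀]
      exact (h n).congr' (hμ.mono fun r hr => key hr.2)
    | zero => simpa using tendsto_const_nhds
    | add G₁ G₂ _ _ h₁ h₂ =>
      simp only [ContinuousMap.add_apply]
      rw [integral_add (integrable_comp_expCube _ G₁) (integrable_comp_expCube _ G₂)]
      refine (h₁.add h₂).congr' (hμ.mono fun r hr => ?_)
      have := hr.1
      exact (integral_add (integrable_comp_expCube _ G₁) (integrable_comp_expCube _ G₂)).symm
    | smul c G _ hG =>
      simp only [ContinuousMap.smul_apply, integral_smul]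
      exact hG.const_smul c
  have hclose : ∀ {ρ : Measure (Fin d → ℝ)} [IsProbabilityMeasure ρ]
      (G : C(Fin d → unitInterval, ℝ)),
      dist (∫ x, F (expCube x) ∂ρ) (∫ x, G (expCube x) ∂ρ) ≤ dist F G := by
    intro ρ _ G
    rw [dist_eq_norm, ← integral_sub (integrable_comp_expCube _ F) (integrable_comp_expCube _ G)]
    refine (norm_integral_le_of_norm_le_const (C := dist F G) (.of_forall fun x => ?_)).trans ?_
    · rw [← dist_eq_norm]
      exact ContinuousMap.dist_apply_le_dist _
    · simp
  rw [Metric.tendsto_nhds]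
  intro ε hε
  have hF : F ∈ closure ((Algebra.adjoin ℝ (Set.range (cubeCoord (d := d))) :
      Subalgebra ℝ C(Fin d → unitInterval, ℝ)) : Set C(Fin d → unitInterval, ℝ)) := by
    rw [← Subalgebra.topologicalClosure_coe, adjoin_cubeCoord_topologicalClosure]
    trivial
  obtain ⟨G, hG, hFG⟩ := Metric.mem_closure_iff.1 hF (ε / 3) (by positivity)
  have hG' : G ∈ Submodule.span ℝ
      (Submonoid.closure (Set.range (cubeCoord (d := d))) : Set C(Fin d → unitInterval, ℝ)) := by
    rw [← Algebra.adjoin_eq_span]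
    exact hG
  filter_upwards [hμ, Metric.tendsto_nhds.1 (hspan G hG') (ε / 3) (by positivity)] with r hr hr'
  have := hr.1
  have h1 := hclose (ρ := μ r) G
  have h2 := hclose (ρ := μ₀) G
  rw [dist_comm] at h2
  linarith [dist_triangle4 (∫ x, F (expCube x) ∂(μ r)) (∫ x, G (expCube x) ∂(μ r))
    (∫ x, G (expCube x) ∂μ₀) (∫ x, F (expCube x) ∂μ₀)]

/-- The continuous function of `t` in the unit cube equal to `g (-log t)` when all coordinates
of `t` are at least `ε`. -/
def pullbackCube (g : BoundedContinuousFunction (Fin d → ℝ) ℝ) {ε : ℝ} (hε : 0 < ε) :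
    C(Fin d → unitInterval, ℝ) :=
  ⟨fun t => g fun i => -Real.log (max (t i) ε), by
    refine g.continuous.comp (continuous_pi fun i => Continuous.neg (Continuous.log ?_ ?_))
    · fun_prop
    · exact fun t => (hε.trans_le (le_max_right _ _)).ne'⟩

/-- A continuous function on the unit cube that is at least one as soon as some
coordinate is at most `ε`, and vanishes when all coordinates are at least `2ε`. -/
def cubeCutoff (ε : ℝ) : C(Fin d → unitInterval, ℝ) :=
  ⟨fun t => ∑ i, min 1 (max 0 (2 - (t i : ℝ) / ε)), by fun_prop⟩

lemma cubeCutoff_apply (ε : ℝ) (t : Fin d → unitInterval) :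
    cubeCutoff ε t = ∑ i, min 1 (max 0 (2 - (t i : ℝ) / ε)) := rfl

lemma cubeCutoff_nonneg (ε : ℝ) (t : Fin d → unitInterval) : 0 ≤ cubeCutoff ε t := by
  rw [cubeCutoff_apply]
  exact Finset.sum_nonneg fun _ _ => le_min zero_le_one (le_max_left _ _)

lemma abs_sub_pullbackCube_le (g : BoundedContinuousFunction (Fin d → ℝ) ℝ) {ε : ℝ} (hε : 0 < ε)
    {x : Fin d → ℝ} (hx : x ∈ posOrthant d) :
    |g x - pullbackCube g hε (expCube x)| ≤ 2 * ‖g‖ * cubeCutoff ε (expCube x) := by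
  by_cases hall : ∀ i, ε ≤ expCube x i
  · have e : pullbackCube g hε (expCube x) = g x := by
      change g _ = g x
      congr 1
      funext i
      rw [max_eq_left (hall i)]
      simp [expCube, hx i]
    rw [e, sub_self, abs_zero]
    exact mul_nonneg (by positivity) (cubeCutoff_nonneg _ _)
  · push Not at hall
    obtain ⟨i, hi⟩ := hall
    have h1 : (1 : ℝ) ≤ cubeCutoff ε (expCube x) := by
      rw [cubeCutoff_apply]
      refine le_trans ?_ (Finset.single_le_sum
        (fun j _ => le_min zero_le_one (le_max_left _ _)) (Finset.mem_univ i))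
      have : (expCube x i : ℝ) / ε ≤ 1 := (div_le_one hε).2 hi.le
      exact le_min le_rfl (le_max_of_le_right (by linarith))
    have h2 : |g x - pullbackCube g hε (expCube x)| ≤ 2 * ‖g‖ := by
      rw [← Real.dist_eq]
      exact g.dist_le_two_norm _ _
    exact h2.trans (le_mul_of_one_le_right (by positivity) h1)

lemma abs_integral_sub_pullbackCube_le (g : BoundedContinuousFunction (Fin d → ℝ) ℝ) {ε : ℝ}
    (hε : 0 < ε) {ρ : Measure (Fin d → ℝ)} [IsProbabilityMeasure ρ]
    (hρ : ∀ᵐ x ∂ρ, x ∈ posOrthant d) :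
    |∫ x, g x ∂ρ - ∫ x, pullbackCube g hε (expCube x) ∂ρ|
      ≤ 2 * ‖g‖ * ∫ x, cubeCutoff ε (expCube x) ∂ρ := by
  rw [← integral_sub (g.integrable ρ) (integrable_comp_expCube _ _), ← integral_const_mul]
  rw [← Real.norm_eq_abs]
  refine norm_integral_le_of_norm_le ((integrable_comp_expCube _ _).const_mul _)
    (hρ.mono fun x hx => ?_)
  exact abs_sub_pullbackCube_le g hε hx

lemma tendsto_integral_cubeCutoff (ρ : Measure (Fin d → ℝ)) [IsProbabilityMeasure ρ] :
    Tendsto (fun n : ℕ => ∫ x, cubeCutoff (1 / ((n : ℝ) + 1)) (expCube x) ∂ρ) atTop (nhds 0) := by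
  have : Tendsto (fun n : ℕ => ∫ x, cubeCutoff (1 / ((n : ℝ) + 1)) (expCube x) ∂ρ) atTop
      (nhds (∫ _, (0 : ℝ) ∂ρ)) := by
    refine tendsto_integral_of_dominated_convergence (fun _ => (d : ℝ))
      (fun n => (integrable_comp_expCube ρ _).aestronglyMeasurable) (integrable_const _)
      (fun n => .of_forall fun x => ?_) (.of_forall fun x => ?_)
    · rw [Real.norm_eq_abs, abs_of_nonneg (cubeCutoff_nonneg _ _), cubeCutoff_apply]
      refine (Finset.sum_le_sum fun i _ => min_le_left _ _).trans (le_of_eq ?_)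
      simp
    · simp only [cubeCutoff_apply]
      have : Tendsto (fun n : ℕ => ∑ i, min 1 (max 0 (2 - (expCube x i : ℝ) / (1 / ((n : ℝ) + 1)))))
          atTop (nhds (∑ _i : Fin d, (0 : ℝ))) := by
        refine tendsto_finsetSum _ fun i _ => ?_
        refine tendsto_const_nhds.congr' ?_
        have ht := (tendsto_natCast_atTop_atTop (R := ℝ)).const_mul_atTop (expCube_pos x i)
        filter_upwards [ht.eventually_ge_atTop 2] with n hn
        have := (expCube_pos x i).le
        rw [max_eq_left, min_eq_right zero_le_one]
        rw [div_div_eq_mul_div, div_one]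
        linarith
      rwa [Finset.sum_const_zero] at this
  simpa using this

/-- A continuity theorem for Laplace transforms of probability measures on the orthant. -/
theorem tendsto_integral_of_tendsto_laplace [IsProbabilityMeasure μ₀]
    (h₀ : ∀ᵐ x ∂μ₀, x ∈ posOrthant d)
    (hμ : ∀ᶠ r in l, IsProbabilityMeasure (μ r) ∧ ∀ᵐ x ∂(μ r), x ∈ posOrthant d)
    (h : ∀ n : Fin d → ℕ, Tendsto (fun r => laplace (μ r) fun i => (n i : ℝ)) l
      (nhds (laplace μ₀ fun i => (n i : ℝ)))) (g : BoundedContinuousFunction (Fin d → ℝ) ℝ) :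
    Tendsto (fun r => ∫ x, g x ∂(μ r)) l (nhds (∫ x, g x ∂μ₀)) := by
  rw [Metric.tendsto_nhds]
  intro δ hδ
  have hcut : Tendsto (fun n : ℕ => 2 * ‖g‖ * ∫ x, cubeCutoff (1 / ((n : ℝ) + 1)) (expCube x) ∂μ₀)
      atTop (nhds 0) := by
    simpa using (tendsto_integral_cubeCutoff μ₀).const_mul (2 * ‖g‖)
  obtain ⟨n, hn⟩ := (hcut.eventually_lt_const (show 0 < δ / 3 by positivity)).exists
  have hε : 0 < 1 / ((n : ℝ) + 1) := by positivity
  have h1 := (tendsto_integral_comp_expCube h₀ hμ h (cubeCutoff (1 / ((n : ℝ) + 1)))).const_mul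
    (2 * ‖g‖)
  have h2 := tendsto_integral_comp_expCube h₀ hμ h (pullbackCube g hε)
  filter_upwards [hμ, h1.eventually_lt_const hn,
    Metric.tendsto_nhds.1 h2 (δ / 3) (by positivity)] with r hr hr1 hr2
  have := hr.1
  have e1 := abs_integral_sub_pullbackCube_le g hε hr.2
  have e2 := abs_integral_sub_pullbackCube_le g hε h₀
  rw [← Real.dist_eq] at e1 e2
  rw [dist_comm] at e2
  linarith [dist_triangle4 (∫ x, g x ∂(μ r)) (∫ x, pullbackCube g hε (expCube x) ∂(μ r))
    (∫ x, pullbackCube g hε (expCube x) ∂μ₀) (∫ x, g x ∂μ₀)]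

end WeakConvergence

section ExponentialLaw

variable {m : ℝ}

lemma expMean_eq_expMeasure (m : ℝ) : expMean m = ProbabilityTheory.expMeasure m⁻¹ := by
  refine withDensity_congr_ae (.of_forall fun x => ?_)
  simp only [ProbabilityTheory.gammaPDF, ProbabilityTheory.gammaPDFReal]
  congr 1
  split_ifs with hx
  · simp [div_eq_inv_mul]
  · rfl

lemma isProbabilityMeasure_expMean (hm : 0 < m) : IsProbabilityMeasure (expMean m) := by
  rw [expMean_eq_expMeasure]
  exact ProbabilityTheory.isProbabilityMeasure_expMeasure (inv_pos.2 hm)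

lemma measurable_expMean_density (m : ℝ) :
    Measurable fun x : ℝ => if 0 ≤ x then m⁻¹ * Real.exp (-x / m) else 0 :=
  Measurable.ite measurableSet_Ici (by fun_prop) measurable_const

lemma ae_nonneg_expMean (m : ℝ) : ∀ᵐ x ∂(expMean m), 0 ≤ x := by
  rw [expMean, ae_withDensity_iff (measurable_expMean_density m).ennreal_ofReal]
  refine .of_forall fun x hx => ?_
  by_contra h
  simp [h] at hx

lemma integral_exp_neg_mul_expMean (hm : 0 < m) {a : ℝ} (ha : 0 ≤ a) :
    ∫ x, Real.exp (-(a * x)) ∂(expMean m) = (1 + a * m)⁻¹ := by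
  have hneg : -(m⁻¹ + a) < 0 := by have := inv_pos.2 hm; linarith
  rw [expMean, integral_withDensity_eq_integral_toReal_smul
    (measurable_expMean_density m).ennreal_ofReal (.of_forall fun _ => ENNReal.ofReal_lt_top)]
  have e : (fun x : ℝ => (ENNReal.ofReal (if 0 ≤ x then m⁻¹ * Real.exp (-x / m) else 0)).toReal
      • Real.exp (-(a * x)))
      = (Set.Ici 0).indicator fun x => m⁻¹ * Real.exp (-(m⁻¹ + a) * x) := by
    funext x
    by_cases hx : 0 ≤ x
    · rw [if_pos hx, Set.indicator_of_mem (Set.mem_Ici.2 hx),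
        ENNReal.toReal_ofReal (by positivity), smul_eq_mul, mul_assoc, ← Real.exp_add]
      congr 2
      ring
    · rw [if_neg hx, Set.indicator_of_notMem (mt Set.mem_Ici.1 hx)]
      simp
  rw [e, integral_indicator measurableSet_Ici, integral_Ici_eq_integral_Ioi, integral_const_mul,
    integral_exp_mul_Ioi hneg, mul_zero, Real.exp_zero]
  field_simp

variable {d : ℕ} {m : Fin d → ℝ}

lemma isProbabilityMeasure_prodExp (hm : ∀ k, 0 < m k) : IsProbabilityMeasure (prodExp m) := by
  have := fun k => isProbabilityMeasure_expMean (hm k)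
  unfold prodExp
  infer_instance

lemma ae_mem_posOrthant_prodExp (hm : ∀ k, 0 < m k) :
    ∀ᵐ x ∂(prodExp m), x ∈ posOrthant d := by
  have := fun k => isProbabilityMeasure_expMean (hm k)
  exact ae_all_iff.2 fun i =>
    (measurePreserving_eval (fun k => expMean (m k)) i).quasiMeasurePreserving.ae
      (ae_nonneg_expMean (m i))

lemma laplace_prodExp (hm : ∀ k, 0 < m k) {η : Fin d → ℝ} (hη : 0 ≤ η) :
    laplace (prodExp m) η = ∏ k, (1 + η k * m k)⁻¹ := by
  have := fun k => isProbabilityMeasure_expMean (hm k)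
  simp only [laplace, prodExp, dotProduct, ← Finset.sum_neg_distrib, Real.exp_sum]
  rw [integral_fintype_prod_eq_prod (fun i (x : ℝ) => Real.exp (-(η i * x)))]
  exact Finset.prod_congr rfl fun k _ => integral_exp_neg_mul_expMean (hm k) (hη k)

end ExponentialLaw

/-- Steady-state convergence of SRBM in the multi-scaling regime for a
nonsingular M-reflection matrix: the scaled stationary distributions converge weakly to a
product of independent exponentials with means `m_k = (u_kᵀ Γ u_k)/(2 u_kᵀ R_{:,k}) > 0`. -/
theorem srbm_steady_state_convergence_M
    {d : ℕ} (hd : 1 ≤ d)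
    (Γ R : Matrix (Fin d) (Fin d) ℝ)
    (hΓsymm : Γ.IsSymm) (hΓpd : Γ.PosDef)
    (hR : IsMMatrix R)
    (π : ℝ → Measure (Fin d → ℝ)) (ν : Fin d → ℝ → Measure (Fin d → ℝ))
    (hBAR : BARFamily Γ R π ν)
    (u : Fin d → Fin d → ℝ) (hu : ∀ k, IsUk R k (u k)) :
    (∀ k, 0 < meanOf Γ R (u k) k) ∧
    ScaledWeakLimit π (prodExp fun k => meanOf Γ R (u k) k) := by
  have hmean : ∀ k, 0 < meanOf Γ R (u k) k := fun k =>
    div_pos (quadForm_pos hΓpd (hu k).ne_zero) (mul_pos two_pos (IsUk.uR_pos hR.2 hu k))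
  refine ⟨hmean, fun g => ?_⟩
  have hcont : ∀ r : ℝ, Continuous fun (z : Fin d → ℝ) (i : Fin d) => r ^ ((i : ℕ) + 1) * z i :=
    fun r => by fun_prop
  have := isProbabilityMeasure_prodExp hmean
  have key := tendsto_integral_of_tendsto_laplace (l := nhdsWithin 0 (Set.Ioo 0 1))
    (μ := fun r => (π r).map fun z i => r ^ ((i : ℕ) + 1) * z i)
    (ae_mem_posOrthant_prodExp hmean) (hBAR.eventually.mono fun r hr => ?_) (fun n => ?_) g
  · refine key.congr fun r => ?_
    exact integral_map (hcont r).aemeasurable g.continuous.aestronglyMeasurable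
  · have := hr.prob
    refine ⟨Measure.isProbabilityMeasure_map (hcont r).aemeasurable, ?_⟩
    refine (ae_map_iff (hcont r).aemeasurable isClosed_posOrthant.measurableSet).2 ?_
    exact hr.ae_orthant.mono fun z hz i => mul_nonneg (pow_nonneg hr.r_mem.1.le _) (hz i)
  · have hn : (0 : Fin d → ℝ) ≤ fun i => (n i : ℝ) := fun i => Nat.cast_nonneg _
    rw [laplace_prodExp hmean hn]
    refine (tendsto_laplace hΓpd hR hBAR hu hn).congr fun r => ?_
    simp only [laplace]
    rw [integral_map (hcont r).aemeasurable
      (Continuous.aestronglyMeasurable (by unfold dotProduct; fun_prop))]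
    refine integral_congr_ae (.of_forall fun z => ?_)
    simp only [dotProduct]
    congr 2
    exact Finset.sum_congr rfl fun i _ => by ring

end SRBMPaper
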